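/- Let d ≥ 1, let E, F ⊂ {1,…,d}, and let α ∈ A(E), β ∈ A(F) satisfy m_E(α) < 0 and m_F(β) < 0. Define the maximal operator 𝕂_*^{(α,E),(β,F)} f(θ) = sup_{0<t≤1} ∫_{(0,π)^d} 𝕂_t^{(α,E),(β,F)}(θ,φ) f(φ) dη_{α,β}(φ) for measurable f ≥ 0. Then there is a constant C such that η_{α,β}{θ ∈ (0,π)^d : 𝕂_*^{(α,E),(β,F)} f(θ) > λ} ≤ (C/λ) ∫_{(0,π)^d} f(θ) dη_{α,β}(θ) for every λ > 0 and every 0 ≤ f ∈ L¹(dη_{α,β}). -/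

import Mathlib

open MeasureTheory

/-- The Jacobi-type kernel
`K_t^{a,b}(θ,φ) = (θφ + t)^{−a−1/2} ((π−θ)(π−φ) + t)^{−b−1/2} t^{−1/2} exp(−c₂(θ−φ)²/t)`. -/
noncomputable def Kj (c₂ a b t θ φ : ℝ) : ℝ :=
  (θ * φ + t) ^ (-a - 1 / 2) * ((Real.pi - θ) * (Real.pi - φ) + t) ^ (-b - 1 / 2) *
    t ^ (-(1 : ℝ) / 2) * Real.exp (-c₂ * (θ - φ) ^ 2 / t)

/-- The product kernel `𝕂_t^{(α,E),(β,F)}(θ,φ)`: the `i`-th factor is the classical kernel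
`K_t^{α_i,β_i}` for `i ∉ E ∪ F`, and acquires the exotic factor `(θ_i φ_i)^{−2α_i}` together
with the sign flip `α_i ↦ −α_i` when `i ∈ E`, resp. `((π−θ_i)(π−φ_i))^{−2β_i}` together with
`β_i ↦ −β_i` when `i ∈ F`. -/
noncomputable def KKj (d : ℕ) (c₂ : ℝ) (E F : Finset (Fin d)) (α β : Fin d → ℝ)
    (t : ℝ) (θ φ : Fin d → ℝ) : ℝ :=
  ∏ i, ((θ i * φ i) ^ (if i ∈ E then -2 * α i else 0) *
    ((Real.pi - θ i) * (Real.pi - φ i)) ^ (if i ∈ F then -2 * β i else 0) *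
    Kj c₂ (if i ∈ E then -α i else α i) (if i ∈ F then -β i else β i) t (θ i) (φ i))

/-- The measure `η_{α,β}` on `(0,π)^d` with density `∏ θ_i^{2α_i+1}(π−θ_i)^{2β_i+1}`. -/
noncomputable def etaM (d : ℕ) (α β : Fin d → ℝ) : Measure (Fin d → ℝ) :=
  ((volume : Measure (Fin d → ℝ)).withDensity fun θ =>
    ENNReal.ofReal (∏ i, θ i ^ (2 * α i + 1) * (Real.pi - θ i) ^ (2 * β i + 1))).restrict
    {θ | ∀ i, 0 < θ i ∧ θ i < Real.pi}

open scoped ENNReal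

/-- Besicovitch weak type bound for the centered maximal function. -/
lemma besi_weak (V : Type*) [MetricSpace V] [SecondCountableTopology V] [HasBesicovitchCovering V]
    [MeasurableSpace V] [BorelSpace V] :
    ∃ N : ℕ, ∀ (ν : Measure V) (h : V → ℝ≥0∞) (c : ℝ≥0∞) (s : Set V),
      (∀ x ∈ s, ∃ R : ℝ, 0 < R ∧ c * ν (Metric.closedBall x R) ≤
        ∫⁻ y in Metric.closedBall x R, h y ∂ν) → c * ν s ≤ N * ∫⁻ y, h y ∂ν := by
  obtain ⟨N, τ, hτ, hN⟩ := HasBesicovitchCovering.no_satelliteConfig (α := V)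
  refine ⟨N, fun ν h c s hs => ?_⟩
  choose! r hr0 hr using hs
  have key : ∀ m : ℕ, c * ν {x ∈ s | r x ≤ m} ≤ N * ∫⁻ y, h y ∂ν := by
    intro m
    let q : Besicovitch.BallPackage {x ∈ s | r x ≤ m} V :=
      { c := fun x => x
        r := fun x => r x
        rpos := fun x => hr0 x x.2.1
        r_bound := m
        r_le := fun x => x.2.2 }
    obtain ⟨u, hu, hu'⟩ := Besicovitch.exist_disjoint_covering_families hτ hN q
    have u_count : ∀ i, (u i).Countable := by
      intro i
      refine (hu i).countable_of_nonempty_interior fun j _ => ?_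
      have : (Metric.ball (j : V) (r j)).Nonempty := Metric.nonempty_ball.2 (q.rpos _)
      exact this.mono Metric.ball_subset_interior_closedBall
    have h1 : ν {x ∈ s | r x ≤ m} ≤ ∑ i : Fin N, ∑' j : u i, ν (Metric.closedBall (q.c j) (q.r j)) := by
      calc ν {x ∈ s | r x ≤ m} ≤ ν (⋃ i : Fin N, ⋃ j ∈ u i, Metric.closedBall (q.c j) (q.r j)) := by
            refine measure_mono ?_
            intro x hx
            have : x ∈ Set.range q.c := ⟨⟨x, hx⟩, rfl⟩
            have := hu' this
            simp only [Set.mem_iUnion] at this ⊢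
            obtain ⟨i, j, hj, hx⟩ := this
            exact ⟨i, j, hj, Metric.ball_subset_closedBall hx⟩
        _ ≤ ∑ i : Fin N, ν (⋃ j ∈ u i, Metric.closedBall (q.c j) (q.r j)) := measure_iUnion_fintype_le _ _
        _ ≤ _ := by
            refine Finset.sum_le_sum fun i _ => ?_
            exact measure_biUnion_le _ (u_count i) _
    calc c * ν {x ∈ s | r x ≤ m} ≤ c * ∑ i : Fin N, ∑' j : u i, ν (Metric.closedBall (q.c j) (q.r j)) := by gcongr
      _ = ∑ i : Fin N, ∑' j : u i, c * ν (Metric.closedBall (q.c j) (q.r j)) := by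
          rw [Finset.mul_sum]; simp_rw [ENNReal.tsum_mul_left]
      _ ≤ ∑ i : Fin N, ∑' j : u i, ∫⁻ y in Metric.closedBall (q.c j) (q.r j), h y ∂ν := by
          gcongr with i _ j
          exact hr _ j.1.2.1
      _ ≤ ∑ i : Fin N, ∫⁻ y, h y ∂ν := by
          gcongr with i
          rw [← lintegral_biUnion (u_count i) (fun j _ => Metric.isClosed_closedBall.measurableSet) (hu i)]
          exact setLIntegral_le_lintegral _ _
      _ = N * ∫⁻ y, h y ∂ν := by simp
  have hU : s = ⋃ m : ℕ, {x ∈ s | r x ≤ m} := by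
    ext x
    simp only [Set.mem_iUnion, Set.mem_setOf_eq]
    constructor
    · intro hx
      obtain ⟨m, hm⟩ := exists_nat_ge (r x)
      exact ⟨m, hx, hm⟩
    · rintro ⟨m, hx, _⟩; exact hx
  have hmono : Monotone fun m : ℕ => {x ∈ s | r x ≤ m} := by
    intro a b hab x hx
    exact ⟨hx.1, hx.2.trans (by exact_mod_cast hab)⟩
  rw [hU, hmono.measure_iUnion, ENNReal.mul_iSup]
  exact iSup_le key

/-- local pieces -/
def IsL (c : ℝ) (μ : Measure ℝ) (k : ℕ → ℝ → ℝ → ℝ≥0∞) : Prop :=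
  (∀ n, Measurable (fun z : ℝ × ℝ => k n z.1 z.2)) ∧
  ∃ (C : ℝ) (D : ℕ) (P Q : ℤ → Set ℝ), 0 < C ∧ (∀ j, MeasurableSet (P j)) ∧
    (∀ j, MeasurableSet (Q j)) ∧ (∀ i j x, x ∈ P i → x ∈ P j → i = j) ∧
    (∀ i j x, x ∈ Q i → x ∈ Q j → i = j) ∧
    (∀ n x y, k n x y ≠ 0 → ∃ j, x ∈ P j ∧ y ∈ Q j) ∧
    ∀ n x y j R, x ∈ P j → y ∈ Q j → (1 / 2 : ℝ) ^ n ≤ R → |x - y| ≤ R →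
      k n x y * μ (Metric.closedBall x R ∩ (P j ∪ Q j)) ≤
        ENNReal.ofReal (C * (R * 2 ^ n) ^ D * Real.exp (-c * ((x - y) * 2 ^ n) ^ 2))

/-- Schur pieces -/
def IsH (μ : Measure ℝ) (k : ℕ → ℝ → ℝ → ℝ≥0∞) : Prop :=
  (∀ n, Measurable (fun z : ℝ × ℝ => k n z.1 z.2)) ∧
  ∃ (H : ℝ → ℝ → ℝ≥0∞) (C : ℝ≥0∞), C ≠ ∞ ∧ Measurable (fun z : ℝ × ℝ => H z.1 z.2) ∧
    (∀ n x y, k n x y ≤ H x y) ∧ ∀ y, ∫⁻ x, H x y ∂μ ≤ C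

lemma pow_exp_bdd (N : ℕ) (c : ℝ) (hc : 0 < c) :
    ∃ B : ℝ, 0 < B ∧ ∀ u : ℝ, 0 ≤ u → u ^ N * Real.exp (-c * u) ≤ B := by
  refine ⟨N.factorial / c ^ N, by positivity, fun u hu => ?_⟩
  have h := Real.pow_div_factorial_le_exp (c * u) (by positivity) N
  have he : Real.exp (-c * u) = (Real.exp (c * u))⁻¹ := by rw [← Real.exp_neg]; ring_nf
  rw [he, ← div_eq_mul_inv, div_le_div_iff₀ (Real.exp_pos _) (by positivity)]
  rw [div_le_iff₀ (by positivity), mul_pow] at h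
  linarith

lemma summable_g (A c : ℝ) (hc : 0 < c) (D : ℕ) :
    Summable fun j : ℕ => A * ((2 : ℝ) ^ j) ^ D * Real.exp (-c * 4 ^ j / 4) := by
  obtain ⟨B, hB, h⟩ := pow_exp_bdd (D + 1) (c / 4) (by positivity)
  have : Summable fun j : ℕ => ((2 : ℝ) ^ j) ^ D * Real.exp (-c * 4 ^ j / 4) := by
    refine Summable.of_nonneg_of_le (fun j => by positivity) (fun j => ?_)
      ((summable_geometric_of_lt_one (r := (1 / 4 : ℝ)) (by norm_num) (by norm_num)).mul_left B)
    have h1 := h (4 ^ j) (by positivity)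
    have h2 : ((2 : ℝ) ^ j) ^ D ≤ (4 ^ j) ^ D := by gcongr; norm_num
    have h3 : Real.exp (-c * 4 ^ j / 4) = Real.exp (-(c / 4) * 4 ^ j) := by ring_nf
    calc ((2 : ℝ) ^ j) ^ D * Real.exp (-c * 4 ^ j / 4) ≤ (4 ^ j) ^ D * Real.exp (-(c / 4) * 4 ^ j) := by
          rw [h3]; gcongr
      _ = ((4 ^ j) ^ (D + 1) * Real.exp (-(c / 4) * 4 ^ j)) * (1 / 4) ^ j := by
          rw [pow_succ, one_div, inv_pow]; field_simp
      _ ≤ B * (1 / 4) ^ j := by gcongr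
  simpa [mul_assoc] using this.mul_left A

lemma prod_exp_le {ι : Type*} [Fintype ι] (c s : ℝ) (hc : 0 < c) (x y : ι → ℝ) :
    ∏ i, Real.exp (-c * ((x i - y i) * s) ^ 2) ≤ Real.exp (-c * (dist x y * s) ^ 2) := by
  rw [← Real.exp_sum, Real.exp_le_exp, ← Finset.mul_sum, neg_mul, neg_mul, neg_le_neg_iff]
  refine mul_le_mul_of_nonneg_left ?_ hc.le
  rcases isEmpty_or_nonempty ι with h | h
  · have : x = y := Subsingleton.elim _ _
    simp [this]
  · obtain ⟨i, hi⟩ : ∃ i, dist x y = dist (x i) (y i) := by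
      obtain ⟨i, _, hi⟩ := Finset.exists_mem_eq_sup' (Finset.univ_nonempty (α := ι)) (fun i => nndist (x i) (y i))
      refine ⟨i, ?_⟩
      rw [dist_pi_def, ← Finset.sup'_eq_sup Finset.univ_nonempty, hi, coe_nndist]
    rw [hi, Real.dist_eq, mul_pow, sq_abs, ← mul_pow]
    exact Finset.single_le_sum (f := fun i => ((x i - y i) * s) ^ 2) (fun i _ => sq_nonneg _) (Finset.mem_univ i)

lemma weakL {ι : Type*} [Fintype ι] (c : ℝ) (hc : 0 < c) (μ : ι → Measure ℝ)
    [∀ i, SigmaFinite (μ i)] (k : ι → ℕ → ℝ → ℝ → ℝ≥0∞) (hk : ∀ i, IsL c (μ i) (k i)) :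
    ∃ C : ℝ≥0∞, C ≠ ∞ ∧ ∀ f : (ι → ℝ) → ℝ≥0∞, Measurable f → ∀ l : ℝ≥0∞,
      l * Measure.pi μ {x | l < ⨆ n, ∫⁻ y, (∏ i, k i n (x i) (y i)) * f y ∂(Measure.pi μ)} ≤
        C * ∫⁻ y, f y ∂(Measure.pi μ) := by
  choose hkm C D P Q hC hPm hQm hPd hQd hsupp hbd using hk
  obtain ⟨N, hN⟩ := besi_weak (ι → ℝ)
  set A : ℝ := (∏ i, C i) * Real.exp (c / 4) with hA
  set DD : ℕ := ∑ i, D i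
  have hCpos : 0 < ∏ i, C i := Finset.prod_pos fun i _ => hC i
  have hApos : 0 < A := by positivity
  set g : ℕ → ℝ≥0∞ := fun j => ENNReal.ofReal (A * ((2 : ℝ) ^ j) ^ DD * Real.exp (-c * 4 ^ j / 4)) with hg
  have hg0 : ∀ j, g j ≠ 0 := fun j => by
    simp only [hg, ne_eq, ENNReal.ofReal_eq_zero, not_le]; positivity
  set G : ℝ≥0∞ := ∑' j, g j with hG
  have hGtop : G ≠ ∞ := (summable_g A c hc DD).tsum_ofReal_ne_top
  have hG0 : G ≠ 0 := by
    intro h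
    exact hg0 0 (ENNReal.tsum_eq_zero.1 h 0)
  refine ⟨G * N, ENNReal.mul_ne_top hGtop (by simp), fun f hf l => ?_⟩
  rcases eq_or_ne l 0 with rfl | hl0
  · simp
  set M := Measure.pi μ
  set T : ℕ → (ι → ℝ) → ℝ≥0∞ := fun n x => ∫⁻ y, (∏ i, k i n (x i) (y i)) * f y ∂M with hT
  set PP : (ι → ℤ) → Set (ι → ℝ) := fun K => Set.pi Set.univ fun i => P i (K i)
  set QQ : (ι → ℤ) → Set (ι → ℝ) := fun K => Set.pi Set.univ fun i => Q i (K i)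
  set SS : (ι → ℤ) → Set (ι → ℝ) := fun K => Set.pi Set.univ fun i => P i (K i) ∪ Q i (K i)
  have hQQm : ∀ K, MeasurableSet (QQ K) := fun K => MeasurableSet.univ_pi fun i => hQm i _
  have hSSm : ∀ K, MeasurableSet (SS K) := fun K => MeasurableSet.univ_pi fun i => (hPm i _).union (hQm i _)
  -- pointwise kernel bound
  have hker : ∀ K n x y, x ∈ PP K → y ∈ QQ K → ∃ j : ℕ, dist x y ≤ 2 ^ j * (1 / 2) ^ n ∧
      ∏ i, k i n (x i) (y i) ≤ g j / M (Metric.closedBall x (2 ^ j * (1 / 2) ^ n) ∩ SS K) := by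
    intro K n x y hx hy
    have hr : (0 : ℝ) < (1 / 2) ^ n := by positivity
    have hex : ∃ j : ℕ, dist x y ≤ 2 ^ j * (1 / 2) ^ n := by
      obtain ⟨j, hj⟩ := pow_unbounded_of_one_lt (dist x y / (1 / 2) ^ n) (one_lt_two (α := ℝ))
      exact ⟨j, by rw [div_lt_iff₀ hr] at hj; exact hj.le⟩
    classical
    have hmin := fun m => Nat.find_min hex (m := m)
    have hj := Nat.find_spec hex
    set j := Nat.find hex
    refine ⟨j, hj, ?_⟩
    rw [ENNReal.le_div_iff_mul_le (Or.inr (hg0 j)) (Or.inr ENNReal.ofReal_ne_top)]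
    set R : ℝ := 2 ^ j * (1 / 2) ^ n with hR
    have hRpos : 0 < R := by positivity
    have hRr : (1 / 2 : ℝ) ^ n ≤ R := by
      rw [hR]; exact le_mul_of_one_le_left hr.le (one_le_pow₀ one_le_two)
    have hR2 : R * 2 ^ n = 2 ^ j := by
      rw [hR, mul_assoc, ← mul_pow]; norm_num
    have hball : Metric.closedBall x R ∩ SS K = Set.pi Set.univ fun i =>
        Metric.closedBall (x i) R ∩ (P i (K i) ∪ Q i (K i)) := by
      rw [closedBall_pi _ hRpos.le, ← Set.pi_inter_distrib]
    rw [hball, Measure.pi_pi, ← Finset.prod_mul_distrib]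
    calc ∏ i, (k i n (x i) (y i) * μ i (Metric.closedBall (x i) R ∩ (P i (K i) ∪ Q i (K i))))
        ≤ ∏ i, ENNReal.ofReal (C i * (R * 2 ^ n) ^ D i * Real.exp (-c * ((x i - y i) * 2 ^ n) ^ 2)) := by
          refine Finset.prod_le_prod' fun i _ => ?_
          refine hbd i n _ _ (K i) R (hx i trivial) (hy i trivial) hRr ?_
          rw [← Real.dist_eq]
          exact (dist_le_pi_dist x y i).trans hj
      _ = ENNReal.ofReal (∏ i, (C i * (R * 2 ^ n) ^ D i * Real.exp (-c * ((x i - y i) * 2 ^ n) ^ 2))) := by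
          rw [ENNReal.ofReal_prod_of_nonneg]
          intro i _; have := hC i; positivity
      _ ≤ g j := by
          refine ENNReal.ofReal_le_ofReal ?_
          rw [Finset.prod_mul_distrib, Finset.prod_mul_distrib, Finset.prod_pow_eq_pow_sum, hR2]
          have h1 := prod_exp_le c (2 ^ n) hc x y
          have h2 : Real.exp (-c * (dist x y * 2 ^ n) ^ 2) ≤ Real.exp (c / 4) * Real.exp (-c * 4 ^ j / 4) := by
            rw [← Real.exp_add, Real.exp_le_exp]
            rcases Nat.eq_zero_or_pos j with h0 | h0
            · rw [h0]
              have : 0 ≤ c * (dist x y * 2 ^ n) ^ 2 := by positivity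
              norm_num at *
              linarith
            · have := hmin (j - 1) (by omega)
              push Not at this
              have h3 : (2 : ℝ) ^ j / 2 ≤ dist x y * 2 ^ n := by
                have e : (2 : ℝ) ^ j = 2 ^ (j - 1) * 2 := by rw [← pow_succ]; congr 1; omega
                have e2 : (1 / 2 : ℝ) ^ n * 2 ^ n = 1 := by rw [← mul_pow]; norm_num
                have := mul_le_mul_of_nonneg_right this.le (show (0 : ℝ) ≤ 2 ^ n by positivity)
                rw [mul_assoc, e2] at this
                rw [e]; linarith
              have h4 : ((2 : ℝ) ^ j / 2) ^ 2 ≤ (dist x y * 2 ^ n) ^ 2 := by gcongr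
              have h5 : ((2 : ℝ) ^ j / 2) ^ 2 = 4 ^ j / 4 := by
                rw [div_pow, ← pow_mul, mul_comm, pow_mul]; norm_num
              rw [h5] at h4
              have := mul_le_mul_of_nonneg_left h4 hc.le
              linarith
          calc (∏ i, C i) * (2 ^ j) ^ DD * ∏ i, Real.exp (-c * ((x i - y i) * 2 ^ n) ^ 2)
              ≤ (∏ i, C i) * (2 ^ j) ^ DD * (Real.exp (c / 4) * Real.exp (-c * 4 ^ j / 4)) := by
                gcongr; exact h1.trans h2
            _ = _ := by rw [hA]; ring
  have hTK : ∀ K n x, x ∈ PP K → l < T n x → ∃ R : ℝ, 0 < R ∧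
      l / G * (M.restrict (SS K)) (Metric.closedBall x R) ≤
        ∫⁻ y in Metric.closedBall x R, (QQ K).indicator f y ∂(M.restrict (SS K)) := by
    intro K n x hx hlT
    by_contra! hcon
    refine absurd hlT (not_lt.2 ?_)
    set R : ℕ → ℝ := fun j => 2 ^ j * (1 / 2) ^ n with hR
    set m : ℕ → ℝ≥0∞ := fun j => M (Metric.closedBall x (R j) ∩ SS K) with hm
    have hR0 : ∀ j, 0 < R j := fun j => by positivity
    have hbm : ∀ j, MeasurableSet (Metric.closedBall x (R j) ∩ SS K) :=
      fun j => Metric.isClosed_closedBall.measurableSet.inter (hSSm K)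
    have hh : Measurable ((QQ K).indicator f) := hf.indicator (hQQm K)
    calc T n x ≤ ∫⁻ y, ∑' j, g j / m j * (Metric.closedBall x (R j) ∩ SS K).indicator ((QQ K).indicator f) y ∂M := by
          refine lintegral_mono fun y => ?_
          by_cases hz : ∏ i, k i n (x i) (y i) = 0
          · simp only [hz, zero_mul, zero_le]
          have hy : y ∈ QQ K := by
            intro i _
            have h1 : k i n (x i) (y i) ≠ 0 := fun h => hz (Finset.prod_eq_zero (Finset.mem_univ i) h)
            obtain ⟨j, hxj, hyj⟩ := hsupp i n _ _ h1
            have e := hPd i j (K i) (x i) hxj (hx i trivial)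
            show y i ∈ Q i (K i)
            rwa [← e]
          obtain ⟨j, hj, hle⟩ := hker K n x y hx hy
          have hyS : y ∈ Metric.closedBall x (R j) ∩ SS K :=
            ⟨by rw [Metric.mem_closedBall, dist_comm]; exact hj, fun i _ => Or.inr (hy i trivial)⟩
          refine le_trans ?_ (ENNReal.le_tsum j)
          rw [Set.indicator_of_mem hyS, Set.indicator_of_mem hy]
          gcongr
      _ = ∑' j, g j / m j * ∫⁻ y in Metric.closedBall x (R j) ∩ SS K, (QQ K).indicator f y ∂M := by
          rw [lintegral_tsum]
          · refine tsum_congr fun j => ?_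
            rw [lintegral_const_mul _ (hh.indicator (hbm j)), lintegral_indicator (hbm j)]
          · intro j
            exact ((hh.indicator (hbm j)).const_mul _).aemeasurable
      _ ≤ ∑' j, g j * (l / G) := by
          refine ENNReal.tsum_le_tsum fun j => ?_
          rw [div_eq_mul_inv, mul_assoc]
          gcongr
          have := hcon (R j) (hR0 j)
          rw [Measure.restrict_restrict Metric.isClosed_closedBall.measurableSet,
            Measure.restrict_apply Metric.isClosed_closedBall.measurableSet] at this
          rw [mul_comm, ← div_eq_mul_inv]
          exact ENNReal.div_le_of_le_mul this.le
      _ = l := by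
          rw [ENNReal.tsum_mul_right, ← hG, ENNReal.mul_div_cancel hG0 hGtop]
  have hK : ∀ K, l / G * M (PP K ∩ {x | l < ⨆ n, T n x}) ≤ N * ∫⁻ y in QQ K, f y ∂M := by
    intro K
    have := hN (M.restrict (SS K)) ((QQ K).indicator f) (l / G) (PP K ∩ {x | l < ⨆ n, T n x}) (by
      rintro x ⟨hx, hx2⟩
      obtain ⟨n, hn⟩ := lt_iSup_iff.1 (show l < ⨆ n, T n x from hx2)
      exact hTK K n x hx hn)
    rw [Measure.restrict_eq_self _ (by
      rintro x ⟨hx, -⟩ i hi; exact Or.inl (hx i hi))] at this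
    refine this.trans (mul_le_mul_right ?_ _)
    rw [← lintegral_indicator (hQQm K)]
    exact setLIntegral_le_lintegral _ _
  have hsub : {x | l < ⨆ n, T n x} ⊆ ⋃ K, PP K ∩ {x | l < ⨆ n, T n x} := by
    intro x hx
    obtain ⟨n, hn⟩ := lt_iSup_iff.1 (show l < ⨆ n, T n x from hx)
    have : ∃ y : ι → ℝ, ∏ i, k i n (x i) (y i) ≠ 0 := by
      by_contra! hcon
      simp [hT, hcon] at hn
    obtain ⟨y, hy⟩ := this
    have : ∀ i, ∃ j, x i ∈ P i j ∧ y i ∈ Q i j := fun i =>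
      hsupp i n _ _ fun h => hy (Finset.prod_eq_zero (Finset.mem_univ i) h)
    choose K hKx _ using this
    exact Set.mem_iUnion.2 ⟨K, fun i _ => hKx i, hx⟩
  have hfin : l / G * M {x | l < ⨆ n, T n x} ≤ N * ∫⁻ y, f y ∂M := by
    calc l / G * M {x | l < ⨆ n, T n x} ≤ l / G * ∑' K, M (PP K ∩ {x | l < ⨆ n, T n x}) := by
          gcongr
          exact (measure_mono hsub).trans (measure_iUnion_le _)
      _ ≤ ∑' K, N * ∫⁻ y in QQ K, f y ∂M := by
          rw [← ENNReal.tsum_mul_left]; exact ENNReal.tsum_le_tsum hK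
      _ ≤ N * ∫⁻ y, f y ∂M := by
          rw [ENNReal.tsum_mul_left]
          gcongr
          rw [← lintegral_iUnion hQQm]
          · exact setLIntegral_le_lintegral _ _
          · intro K K' hne
            refine Set.disjoint_left.2 fun y hy hy' => hne ?_
            funext i
            exact hQd i _ _ _ (hy i trivial) (hy' i trivial)
  calc l * M {x | l < ⨆ n, T n x} = G * (l / G * M {x | l < ⨆ n, T n x}) := by
        rw [← mul_assoc, ENNReal.mul_div_cancel hG0 hGtop]
    _ ≤ G * (N * ∫⁻ y, f y ∂M) := by gcongr
    _ = _ := by rw [mul_assoc]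

lemma meas2 {α : Type*} [MeasurableSpace α] {h : ℝ → ℝ → ℝ≥0∞}
    (hh : Measurable fun z : ℝ × ℝ => h z.1 z.2) {u v : α → ℝ} (hu : Measurable u)
    (hv : Measurable v) : Measurable fun a => h (u a) (v a) :=
  hh.comp (hu.prodMk hv)

lemma lintegral_fin_pi_prod (n : ℕ) (μ : Fin n → Measure ℝ) [∀ i, SigmaFinite (μ i)]
    (f : Fin n → ℝ → ℝ≥0∞) (hf : ∀ i, Measurable (f i)) :
    ∫⁻ x, ∏ i, f i (x i) ∂(Measure.pi μ) = ∏ i, ∫⁻ x, f i x ∂(μ i) := by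
  induction n with
  | zero => simp
  | succ n ih =>
    have h := (measurePreserving_piFinSuccAbove μ 0).symm
    rw [h.lintegral_map_equiv]
    have : ∀ z : ℝ × (Fin n → ℝ), ∏ i, f i ((MeasurableEquiv.piFinSuccAbove (fun _ => ℝ) 0).symm z i) =
        f 0 z.1 * ∏ i : Fin n, f i.succ (z.2 i) := by
      intro z
      rw [Fin.prod_univ_succ]
      simp [MeasurableEquiv.piFinSuccAbove, Fin.insertNthEquiv]
    refine (lintegral_congr this).trans ?_
    rw [Fin.prod_univ_succ, ← ih (fun i => μ i.succ) (fun i => f i.succ) (fun i => hf _)]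
    rw [← lintegral_prod_mul (hf 0).aemeasurable]
    · rfl
    · exact (Finset.measurable_prod _ fun i _ => (hf _).comp (measurable_pi_apply i)).aemeasurable

lemma lintegral_pi_prod {ι : Type*} [Fintype ι] (μ : ι → Measure ℝ) [∀ i, SigmaFinite (μ i)]
    (f : ι → ℝ → ℝ≥0∞) (hf : ∀ i, Measurable (f i)) :
    ∫⁻ x, ∏ i, f i (x i) ∂(Measure.pi μ) = ∏ i, ∫⁻ x, f i x ∂(μ i) := by
  let e := (Fintype.equivFin ι).symm
  rw [(measurePreserving_piCongrLeft μ e).lintegral_map_equiv]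
  simp_rw [← e.prod_comp, MeasurableEquiv.coe_piCongrLeft]
  have := lintegral_fin_pi_prod _ (fun i => μ (e i)) (fun i => f (e i)) (fun i => hf _)
  rw [← this]
  refine lintegral_congr fun x => ?_
  refine Finset.prod_congr rfl fun i _ => ?_
  congr 1
  exact Equiv.piCongrLeft_apply_apply (P := fun _ => ℝ) e x i

lemma weakMix {ι : Type*} [Fintype ι] (c : ℝ) (hc : 0 < c) (μ : ι → Measure ℝ)
    [∀ i, SigmaFinite (μ i)] (k : ι → ℕ → ℝ → ℝ → ℝ≥0∞)
    (hk : ∀ i, IsL c (μ i) (k i) ∨ IsH (μ i) (k i)) :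
    ∃ C : ℝ≥0∞, C ≠ ∞ ∧ ∀ f : (ι → ℝ) → ℝ≥0∞, Measurable f → ∀ l : ℝ≥0∞,
      l * Measure.pi μ {x | l < ⨆ n, ∫⁻ y, (∏ i, k i n (x i) (y i)) * f y ∂(Measure.pi μ)} ≤
        C * ∫⁻ y, f y ∂(Measure.pi μ) := by
  classical
  let p : ι → Prop := fun i => IsL c (μ i) (k i)
  have hH : ∀ i : {i // ¬ p i}, IsH (μ i) (k i) := fun i => (hk i).resolve_left i.2
  have hkm : ∀ i n, Measurable (fun z : ℝ × ℝ => k i n z.1 z.2) := fun i =>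
    (hk i).elim (fun h => h.1) (fun h => h.1)
  obtain ⟨C, hC, hweak⟩ := weakL c hc (fun i : {i // p i} => μ i) (fun i => k i) (fun i => i.2)
  choose _ H CH hCH hHm hkH hHint using hH
  set M1 := Measure.pi (fun i : {i // p i} => μ i)
  set M2 := Measure.pi (fun i : {i // ¬ p i} => μ i)
  set e := MeasurableEquiv.piEquivPiSubtypeProd (fun _ : ι => ℝ) p with he
  have hmp : MeasurePreserving e (Measure.pi μ) (M1.prod M2) := measurePreserving_piEquivPiSubtypeProd μ p
  refine ⟨C * ∏ i, CH i, ENNReal.mul_ne_top hC (ENNReal.prod_ne_top fun i _ => hCH i), fun f hf l => ?_⟩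
  set F : ({i // p i} → ℝ) × ({i // ¬ p i} → ℝ) → ℝ≥0∞ := fun z => f (e.symm z) with hF
  have hFm : Measurable F := hf.comp e.symm.measurable
  have hfF : ∀ y, f y = F (e y) := fun y => by simp [hF]
  set HH : ({i // ¬ p i} → ℝ) → ({i // ¬ p i} → ℝ) → ℝ≥0∞ := fun x y => ∏ i, H i (x i) (y i) with hHH
  have hHHm : Measurable (fun z : ({i // ¬ p i} → ℝ) × ({i // ¬ p i} → ℝ) => HH z.1 z.2) := by
    refine Finset.measurable_prod _ fun i _ => ?_
    exact meas2 (hHm i) (by fun_prop) (by fun_prop)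
  set g : ({i // ¬ p i} → ℝ) → ({i // p i} → ℝ) → ℝ≥0∞ := fun x2 y1 => ∫⁻ y2, HH x2 y2 * F (y1, y2) ∂M2 with hg
  have hgm : Measurable (fun z : ({i // ¬ p i} → ℝ) × ({i // p i} → ℝ) => g z.1 z.2) := by
    refine Measurable.lintegral_prod_right' (f := fun w : (({i // ¬ p i} → ℝ) × ({i // p i} → ℝ)) × ({i // ¬ p i} → ℝ) => HH w.1.1 w.2 * F (w.1.2, w.2)) ?_
    refine Measurable.mul ?_ ?_
    · exact hHHm.comp (measurable_fst.fst.prodMk measurable_snd)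
    · exact hFm.comp (measurable_fst.snd.prodMk measurable_snd)
  set S : ℕ → ({i // p i} → ℝ) × ({i // ¬ p i} → ℝ) → ℝ≥0∞ := fun n z =>
    ∫⁻ y1, (∏ i : {i // p i}, k i n (z.1 i) (y1 i)) * g z.2 y1 ∂M1 with hS
  have hSm : ∀ n, Measurable (S n) := by
    intro n
    refine Measurable.lintegral_prod_right' (f := fun w : (({i // p i} → ℝ) × ({i // ¬ p i} → ℝ)) × ({i // p i} → ℝ) => (∏ i : {i // p i}, k i n (w.1.1 i) (w.2 i)) * g w.1.2 w.2) ?_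
    refine Measurable.mul ?_ ?_
    · refine Finset.measurable_prod _ fun i _ => ?_
      exact meas2 (hkm i n) (by fun_prop) (by fun_prop)
    · exact hgm.comp (measurable_fst.snd.prodMk measurable_snd)
  set A0 : Set (({i // p i} → ℝ) × ({i // ¬ p i} → ℝ)) := {z | l < ⨆ n, S n z} with hA0
  have hA0m : MeasurableSet A0 := measurableSet_lt measurable_const (Measurable.iSup hSm)
  have hTS : ∀ n x, ∫⁻ y, (∏ i, k i n (x i) (y i)) * f y ∂(Measure.pi μ) ≤ S n (e x) := by
    intro n x
    have h1 : ∀ y, (∏ i, k i n (x i) (y i)) * f y ≤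
        (fun z : ({i // p i} → ℝ) × ({i // ¬ p i} → ℝ) =>
          (∏ i : {i // p i}, k i n ((e x).1 i) (z.1 i)) * (HH (e x).2 z.2 * F z)) (e y) := by
      intro y
      simp only
      rw [← hfF y, ← mul_assoc, ← Fintype.prod_subtype_mul_prod_subtype p]
      refine mul_le_mul_left (mul_le_mul' le_rfl ?_) _
      exact Finset.prod_le_prod' fun i _ => hkH i n _ _
    refine (lintegral_mono h1).trans ?_
    rw [← hmp.lintegral_map_equiv (fun z : ({i // p i} → ℝ) × ({i // ¬ p i} → ℝ) =>
          (∏ i : {i // p i}, k i n ((e x).1 i) (z.1 i)) * (HH (e x).2 z.2 * F z)) e]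
    rw [lintegral_prod]
    · simp only [hS, hg]
      refine lintegral_mono fun y1 => ?_
      rw [lintegral_const_mul]
      refine Measurable.mul ?_ ?_
      · exact hHHm.comp (measurable_const.prodMk measurable_id)
      · exact hFm.comp (measurable_const.prodMk measurable_id)
    · refine Measurable.aemeasurable ?_
      refine Measurable.mul ?_ (Measurable.mul ?_ hFm)
      · refine Finset.measurable_prod _ fun i _ => ?_
        exact meas2 (hkm i n) (by fun_prop) (by fun_prop)
      · exact hHHm.comp (measurable_const.prodMk measurable_snd)
  calc l * Measure.pi μ {x | l < ⨆ n, ∫⁻ y, (∏ i, k i n (x i) (y i)) * f y ∂(Measure.pi μ)}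
      ≤ l * Measure.pi μ (e ⁻¹' A0) := by
        gcongr
        intro x hx
        exact lt_of_lt_of_le hx (iSup_mono fun n => hTS n x)
    _ = l * ∫⁻ x2, M1 ((fun x1 => (x1, x2)) ⁻¹' A0) ∂M2 := by
        rw [hmp.measure_preimage hA0m.nullMeasurableSet, Measure.prod_apply_symm hA0m]
    _ = ∫⁻ x2, l * M1 ((fun x1 => (x1, x2)) ⁻¹' A0) ∂M2 := by
        rw [lintegral_const_mul]
        exact measurable_measure_prodMk_right hA0m
    _ ≤ ∫⁻ x2, C * ∫⁻ y1, g x2 y1 ∂M1 ∂M2 := by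
        refine lintegral_mono fun x2 => ?_
        exact hweak (g x2) (hgm.comp (measurable_const.prodMk measurable_id)) l
    _ = C * ∫⁻ x2, ∫⁻ y1, g x2 y1 ∂M1 ∂M2 := by
        rw [lintegral_const_mul]
        exact hgm.lintegral_prod_right'
    _ = C * ∫⁻ y1, ∫⁻ x2, g x2 y1 ∂M2 ∂M1 := by
        rw [lintegral_lintegral_swap hgm.aemeasurable]
    _ = C * ∫⁻ y1, ∫⁻ y2, (∫⁻ x2, HH x2 y2 ∂M2) * F (y1, y2) ∂M2 ∂M1 := by
        congr 1
        refine lintegral_congr fun y1 => ?_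
        simp only [hg]
        rw [lintegral_lintegral_swap]
        · refine lintegral_congr fun y2 => ?_
          rw [lintegral_mul_const]
          exact hHHm.comp (measurable_id.prodMk measurable_const)
        · refine Measurable.aemeasurable ?_
          refine Measurable.mul hHHm ?_
          exact hFm.comp (measurable_const.prodMk measurable_snd)
    _ ≤ C * ∫⁻ y1, ∫⁻ y2, (∏ i, CH i) * F (y1, y2) ∂M2 ∂M1 := by
        gcongr with y1 y2
        rw [hHH, lintegral_pi_prod (fun i : {i // ¬ p i} => μ i) (fun i t => H i t (y2 i))
          (fun i => (hHm i).comp (measurable_id.prodMk measurable_const))]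
        exact Finset.prod_le_prod' fun i _ => hHint i _
    _ = C * ((∏ i, CH i) * ∫⁻ y, f y ∂(Measure.pi μ)) := by
        congr 1
        rw [lintegral_congr hfF, ← hmp.lintegral_map_equiv, lintegral_prod _ hFm.aemeasurable,
          ← lintegral_const_mul]
        · refine lintegral_congr fun y1 => ?_
          rw [lintegral_const_mul]
          exact hFm.comp (measurable_const.prodMk measurable_id)
        · exact hFm.lintegral_prod_right'
    _ = _ := by rw [mul_assoc]

/-- finite sums of local and Schur pieces -/
def Good (c : ℝ) (μ : Measure ℝ) (k : ℕ → ℝ → ℝ → ℝ≥0∞) : Prop :=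
  ∃ (m : ℕ) (q : Fin m → ℕ → ℝ → ℝ → ℝ≥0∞), (∀ j, IsL c μ (q j) ∨ IsH μ (q j)) ∧
    ∀ n x y, k n x y ≤ ∑ j, q j n x y

lemma Good.ofL {c μ k} (h : IsL c μ k) : Good c μ k :=
  ⟨1, fun _ => k, fun _ => Or.inl h, fun n x y => by simp⟩

lemma Good.ofH {c μ k} (h : IsH μ k) : Good c μ k :=
  ⟨1, fun _ => k, fun _ => Or.inr h, fun n x y => by simp⟩

lemma Good.add {c μ k k₁ k₂} (h1 : Good c μ k₁) (h2 : Good c μ k₂)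
    (h : ∀ n x y, k n x y ≤ k₁ n x y + k₂ n x y) : Good c μ k := by
  obtain ⟨m1, q1, hq1, hk1⟩ := h1
  obtain ⟨m2, q2, hq2, hk2⟩ := h2
  refine ⟨m1 + m2, Fin.append q1 q2, fun j => ?_, fun n x y => ?_⟩
  · refine Fin.addCases (fun j => ?_) (fun j => ?_) j
    · rw [Fin.append_left]; exact hq1 j
    · rw [Fin.append_right]; exact hq2 j
  · rw [Fin.sum_univ_add]
    simp only [Fin.append_left, Fin.append_right]
    exact (h n x y).trans (add_le_add (hk1 n x y) (hk2 n x y))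

lemma weakGood {ι : Type*} [Fintype ι] (c : ℝ) (hc : 0 < c) (μ : ι → Measure ℝ)
    [∀ i, SigmaFinite (μ i)] (k : ι → ℕ → ℝ → ℝ → ℝ≥0∞)
    (hk : ∀ i, Good c (μ i) (k i)) :
    ∃ C : ℝ≥0∞, C ≠ ∞ ∧ ∀ f : (ι → ℝ) → ℝ≥0∞, Measurable f → ∀ l : ℝ≥0∞,
      l * Measure.pi μ {x | l < ⨆ n, ∫⁻ y, (∏ i, k i n (x i) (y i)) * f y ∂(Measure.pi μ)} ≤
        C * ∫⁻ y, f y ∂(Measure.pi μ) := by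
  classical
  choose m q hq hkq using hk
  have hw := fun J : (∀ i, Fin (m i)) => weakMix c hc μ (fun i => q i (J i)) (fun i => hq i (J i))
  choose C hC hweak using hw
  set L : ℝ≥0∞ := (Fintype.card (∀ i, Fin (m i)) : ℝ≥0∞) with hL
  refine ⟨L * ∑ J, C J, ENNReal.mul_ne_top (ENNReal.natCast_ne_top _) (ENNReal.sum_ne_top.2 fun J _ => hC J), fun f hf l => ?_⟩
  have hqm : ∀ i j n, Measurable (fun z : ℝ × ℝ => q i j n z.1 z.2) := fun i j =>
    (hq i j).elim (fun h => h.1) (fun h => h.1)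
  set T : (∀ i, Fin (m i)) → ℕ → (ι → ℝ) → ℝ≥0∞ := fun J n x =>
    ∫⁻ y, (∏ i, q i (J i) n (x i) (y i)) * f y ∂(Measure.pi μ) with hT
  have hle : ∀ n x, ∫⁻ y, (∏ i, k i n (x i) (y i)) * f y ∂(Measure.pi μ) ≤ ∑ J, T J n x := by
    intro n x
    simp only [hT]
    rw [← lintegral_finsetSum]
    · refine lintegral_mono fun y => ?_
      rw [← Finset.sum_mul]
      gcongr
      calc ∏ i, k i n (x i) (y i) ≤ ∏ i, ∑ j, q i j n (x i) (y i) :=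
            Finset.prod_le_prod' fun i _ => hkq i n _ _
        _ = _ := by rw [Finset.prod_univ_sum, Fintype.piFinset_univ]
    · intro J _
      refine Measurable.mul ?_ hf
      refine Finset.measurable_prod _ fun i _ => ?_
      exact meas2 (hqm i _ n) (by fun_prop) (by fun_prop)
  rcases eq_or_ne L 0 with h0 | h0
  · have : IsEmpty (∀ i, Fin (m i)) := by
      rw [hL] at h0
      exact Fintype.card_eq_zero_iff.1 (by exact_mod_cast h0)
    have hz : ∀ n (x : ι → ℝ), ∫⁻ y, (∏ i, k i n (x i) (y i)) * f y ∂(Measure.pi μ) = 0 := fun n x =>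
      le_antisymm ((hle n x).trans (by simp)) (by simp)
    simp [hz]
  have hLt : L ≠ ∞ := ENNReal.natCast_ne_top _
  have hsub : {x | l < ⨆ n, ∫⁻ y, (∏ i, k i n (x i) (y i)) * f y ∂(Measure.pi μ)} ⊆
      ⋃ J, {x | l / L < ⨆ n, T J n x} := by
    intro x hx
    obtain ⟨n, hn⟩ := lt_iSup_iff.1 (show l < ⨆ n, ∫⁻ y, (∏ i, k i n (x i) (y i)) * f y ∂(Measure.pi μ) from hx)
    by_contra hcon
    simp only [Set.mem_iUnion, not_exists] at hcon
    have h2 : ∀ J, T J n x ≤ l / L := fun J =>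
      (le_iSup (fun n => T J n x) n).trans (not_lt.1 (hcon J))
    have := hn.trans_le ((hle n x).trans (Finset.sum_le_sum fun J _ => h2 J))
    rw [Finset.sum_const, Finset.card_univ, nsmul_eq_mul, ← hL, ENNReal.mul_div_cancel h0 hLt] at this
    exact lt_irrefl _ this
  calc _ ≤ l * ∑ J, Measure.pi μ {x | l / L < ⨆ n, T J n x} := by
        gcongr
        exact (measure_mono hsub).trans (measure_iUnion_fintype_le _ _)
    _ = L * ∑ J, l / L * Measure.pi μ {x | l / L < ⨆ n, T J n x} := by
        rw [← Finset.mul_sum, ← mul_assoc, ENNReal.mul_div_cancel h0 hLt]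
    _ ≤ L * ∑ J, C J * ∫⁻ y, f y ∂(Measure.pi μ) := by
        refine mul_le_mul_right (Finset.sum_le_sum fun J _ => ?_) _
        exact hweak J f hf _
    _ = _ := by rw [← Finset.sum_mul, mul_assoc]

lemma rpow_cmp (u v M e : ℝ) (hv : 0 < v) (hM : 1 ≤ M) (h1 : v / M ≤ u) (h2 : u ≤ M * v) :
    u ^ e ≤ M ^ |e| * v ^ e := by
  have hM0 : 0 < M := by linarith
  have hu : 0 < u := lt_of_lt_of_le (by positivity) h1
  rcases le_total 0 e with he | he
  · rw [abs_of_nonneg he, ← Real.mul_rpow hM0.le hv.le]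
    exact Real.rpow_le_rpow hu.le h2 he
  · rw [abs_of_nonpos he]
    calc u ^ e ≤ (v / M) ^ e := Real.rpow_le_rpow_of_nonpos (by positivity) h1 he
      _ = _ := by rw [Real.div_rpow hv.le hM0.le, Real.rpow_neg hM0.le]; field_simp

lemma rpow_bdd (m M e : ℝ) (hm : 0 < m) : ∃ C : ℝ, 0 < C ∧ ∀ u, m ≤ u → u ≤ M → u ^ e ≤ C := by
  refine ⟨m ^ e + |M| ^ e + 1, by positivity, fun u h1 h2 => ?_⟩
  have a1 : 0 ≤ m ^ e := by positivity
  have a2 : 0 ≤ |M| ^ e := by positivity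
  rcases le_total 0 e with he | he
  · have := Real.rpow_le_rpow (by linarith) (h2.trans (le_abs_self M)) he
    linarith
  · have := Real.rpow_le_rpow_of_nonpos hm h1 he
    linarith

lemma rpow_exp_bdd (N c : ℝ) (hN : 0 ≤ N) (hc : 0 < c) :
    ∃ B : ℝ, 0 < B ∧ ∀ u : ℝ, 0 ≤ u → u ^ N * Real.exp (-c * u) ≤ B := by
  obtain ⟨B, hB, h⟩ := pow_exp_bdd ⌈N⌉₊ c hc
  refine ⟨1 + B, by positivity, fun u hu => ?_⟩
  have he : Real.exp (-c * u) ≤ 1 := Real.exp_le_one_iff.2 (by nlinarith)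
  rcases le_total u 1 with h1 | h1
  · have : u ^ N ≤ 1 := Real.rpow_le_one hu h1 hN
    have h2 : u ^ N * Real.exp (-c * u) ≤ 1 * 1 := by gcongr
    linarith
  · have : u ^ N ≤ u ^ ⌈N⌉₊ := by
      rw [← Real.rpow_natCast]
      exact Real.rpow_le_rpow_of_exponent_le h1 (Nat.le_ceil N)
    have h2 : u ^ N * Real.exp (-c * u) ≤ u ^ ⌈N⌉₊ * Real.exp (-c * u) := by gcongr
    linarith [h u hu]

lemma lint_rpow (w b : ℝ) (hw : -1 < w) (hb : 0 ≤ b) :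
    ∫⁻ u in Set.Ioc 0 b, ENNReal.ofReal (u ^ w) = ENNReal.ofReal (b ^ (w + 1) / (w + 1)) := by
  rw [← ofReal_integral_eq_lintegral_ofReal]
  · rw [← intervalIntegral.integral_of_le hb, integral_rpow (Or.inl hw), Real.zero_rpow (by linarith)]
    simp
  · exact (intervalIntegrable_iff_integrableOn_Ioc_of_le hb).1 (intervalIntegral.intervalIntegrable_rpow' hw)
  · filter_upwards [ae_restrict_mem measurableSet_Ioc] with u hu
    exact Real.rpow_nonneg hu.1.le _

lemma lint_const_le (S : Set ℝ) (x R K : ℝ) (hS : S ⊆ Metric.closedBall x R) (hR : 0 ≤ R) (hK : 0 ≤ K)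
    (hSm : MeasurableSet S) (f : ℝ → ℝ) (hf : ∀ u ∈ S, f u ≤ K) :
    ∫⁻ u in S, ENNReal.ofReal (f u) ≤ ENNReal.ofReal (2 * R * K) := by
  calc ∫⁻ u in S, ENNReal.ofReal (f u) ≤ ∫⁻ u in S, ENNReal.ofReal K := by
        refine setLIntegral_mono' hSm fun u hu => ENNReal.ofReal_le_ofReal (hf u hu)
    _ = ENNReal.ofReal K * volume S := by simp
    _ ≤ ENNReal.ofReal K * volume (Metric.closedBall x R) := by gcongr
    _ = _ := by rw [Real.volume_closedBall, ← ENNReal.ofReal_mul hK, mul_comm]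

lemma lint_ball (a : ℝ) (ha : -1 < a) : ∃ C : ℝ, 0 < C ∧ ∀ x R : ℝ, 0 < x → 0 < R →
    ∫⁻ u in Metric.closedBall x R ∩ Set.Ioi 0, ENNReal.ofReal (u ^ (2 * a + 1)) ≤
      ENNReal.ofReal (C * R * (x + R) ^ (2 * a + 1)) := by
  set w := 2 * a + 1 with hw
  have hw1 : 0 < w + 1 := by rw [hw]; linarith
  refine ⟨2 * 3 ^ |w| + 3 / (w + 1), by positivity, fun x R hx hR => ?_⟩
  have hm : MeasurableSet (Metric.closedBall x R ∩ Set.Ioi 0) :=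
    Metric.isClosed_closedBall.measurableSet.inter measurableSet_Ioi
  have hpos : 0 < (x + R) ^ w := by positivity
  rcases lt_or_ge R (x / 2) with h | h
  · refine (lint_const_le _ x R (3 ^ |w| * (x + R) ^ w) Set.inter_subset_left hR.le (by positivity) hm _ ?_).trans ?_
    · rintro u ⟨hu, -⟩
      rw [Metric.mem_closedBall, Real.dist_eq, abs_le] at hu
      refine rpow_cmp _ _ _ _ (by positivity) (by norm_num) ?_ ?_ <;> linarith
    · refine ENNReal.ofReal_le_ofReal ?_
      have : 0 ≤ 3 / (w + 1) * R * (x + R) ^ w := by positivity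
      nlinarith
  · calc _ ≤ ∫⁻ u in Set.Ioc 0 (x + R), ENNReal.ofReal (u ^ w) := by
          refine lintegral_mono_set ?_
          rintro u ⟨hu, hu0⟩
          rw [Metric.mem_closedBall, Real.dist_eq, abs_le] at hu
          exact ⟨hu0, by linarith⟩
      _ = ENNReal.ofReal ((x + R) ^ (w + 1) / (w + 1)) := lint_rpow w _ (by linarith) (by positivity)
      _ ≤ _ := by
          refine ENNReal.ofReal_le_ofReal ?_
          rw [Real.rpow_add_one (by positivity)]
          have h1 : (x + R) ^ w * (x + R) / (w + 1) ≤ (x + R) ^ w * (3 * R) / (w + 1) := by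
            gcongr; linarith
          have h2 : 0 ≤ 2 * 3 ^ |w| * R * (x + R) ^ w := by positivity
          have h3 : (x + R) ^ w * (3 * R) / (w + 1) = 3 / (w + 1) * R * (x + R) ^ w := by ring
          nlinarith

/-- one dimensional measure -/
noncomputable def mu1 (a b : ℝ) : Measure ℝ :=
  ((volume : Measure ℝ).withDensity fun x =>
    ENNReal.ofReal (x ^ (2 * a + 1) * (Real.pi - x) ^ (2 * b + 1))).restrict (Set.Ioo 0 Real.pi)

instance (a b : ℝ) : SigmaFinite (mu1 a b) := by unfold mu1; infer_instance

/-- full one dimensional kernel -/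
noncomputable def kk (c p p' A B t x y : ℝ) : ℝ :=
  (x * y) ^ p * ((Real.pi - x) * (Real.pi - y)) ^ p' * Kj c A B t x y

open Classical in
/-- one dimensional kernel cut off to a region -/
noncomputable def kG (c p p' A B : ℝ) (G : Set (ℝ × ℝ)) (n : ℕ) (x y : ℝ) : ℝ≥0∞ :=
  if (x, y) ∈ G then ENNReal.ofReal (kk c p p' A B ((1 / 4) ^ n) x y) else 0

lemma kG_meas (c p p' A B : ℝ) (G : Set (ℝ × ℝ)) (hG : MeasurableSet G) (n : ℕ) :
    Measurable (fun z : ℝ × ℝ => kG c p p' A B G n z.1 z.2) := by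
  unfold kG
  refine Measurable.ite hG ?_ measurable_const
  unfold kk Kj
  fun_prop

lemma dens_meas (a b : ℝ) : Measurable fun x : ℝ =>
    ENNReal.ofReal (x ^ (2 * a + 1) * (Real.pi - x) ^ (2 * b + 1)) := by
  fun_prop

lemma mu1_lint (a b : ℝ) (f : ℝ → ℝ≥0∞) (hf : Measurable f) :
    ∫⁻ x, f x ∂(mu1 a b) = ∫⁻ x in Set.Ioo 0 Real.pi,
      ENNReal.ofReal (x ^ (2 * a + 1) * (Real.pi - x) ^ (2 * b + 1)) * f x := by
  unfold mu1
  rw [restrict_withDensity measurableSet_Ioo, lintegral_withDensity_eq_lintegral_mul _ (dens_meas a b) hf]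
  rfl

/-- the interval near zero -/
def I0 : Set ℝ := Set.Ioo 0 (2 * Real.pi / 3)

lemma I0_meas : MeasurableSet I0 := measurableSet_Ioo

lemma I0_sub : I0 ⊆ Set.Ioo 0 Real.pi := fun x hx => ⟨hx.1, by
  have h1 : x < 2 * Real.pi / 3 := hx.2
  have := Real.pi_pos
  linarith⟩

lemma mu1_I0 (a b : ℝ) : ∃ C : ℝ, 0 < C ∧ ∀ x ∈ I0,
    ENNReal.ofReal (x ^ (2 * a + 1) * (Real.pi - x) ^ (2 * b + 1)) ≤
      ENNReal.ofReal C * ENNReal.ofReal (x ^ (2 * a + 1)) := by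
  obtain ⟨C, hC, h⟩ := rpow_bdd (Real.pi / 3) Real.pi (2 * b + 1) (by positivity)
  refine ⟨C, hC, fun x hx => ?_⟩
  rw [← ENNReal.ofReal_mul hC.le, mul_comm C]
  refine ENNReal.ofReal_le_ofReal ?_
  have h1 := hx.1
  have h2 := hx.2
  gcongr
  exact h _ (by linarith) (by linarith)

lemma mu1_set (a b : ℝ) : ∃ C : ℝ, 0 < C ∧ ∀ S ⊆ I0, MeasurableSet S →
    mu1 a b S ≤ ENNReal.ofReal C * ∫⁻ x in S, ENNReal.ofReal (x ^ (2 * a + 1)) := by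
  obtain ⟨C, hC, h⟩ := mu1_I0 a b
  refine ⟨C, hC, fun S hS hSm => ?_⟩
  unfold mu1
  rw [Measure.restrict_eq_self _ (hS.trans I0_sub), withDensity_apply _ hSm, ← lintegral_const_mul _ (by fun_prop)]
  exact setLIntegral_mono' hSm fun x hx => h x (hS hx)

lemma kk_I0 (c p p' A B : ℝ) (hc : 0 < c) : ∃ C : ℝ, 0 < C ∧ ∀ (n : ℕ) (x y : ℝ), x ∈ I0 → y ∈ I0 →
    kk c p p' A B ((1 / 4) ^ n) x y ≤ C * ((x * y) ^ p * (x * y + (1 / 4) ^ n) ^ (-A - 1 / 2) * 2 ^ n *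
      Real.exp (-c * ((x - y) * 2 ^ n) ^ 2)) := by
  obtain ⟨C1, hC1, h1⟩ := rpow_bdd (Real.pi / 3 * (Real.pi / 3)) (Real.pi * Real.pi) p' (by positivity)
  obtain ⟨C2, hC2, h2⟩ := rpow_bdd (Real.pi / 3 * (Real.pi / 3)) (Real.pi * Real.pi + 1) (-B - 1 / 2) (by positivity)
  refine ⟨C1 * C2, by positivity, fun n x y hx hy => ?_⟩
  have x1 := hx.1
  have x2 := hx.2
  have y1 := hy.1
  have y2 := hy.2
  have ht0 : (0 : ℝ) < (1 / 4) ^ n := by positivity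
  have ht1 : (1 / 4 : ℝ) ^ n ≤ 1 := pow_le_one₀ (by norm_num) (by norm_num)
  have l1 : Real.pi / 3 * (Real.pi / 3) ≤ (Real.pi - x) * (Real.pi - y) := by
    have := Real.pi_pos
    gcongr <;> linarith
  have l2 : (Real.pi - x) * (Real.pi - y) ≤ Real.pi * Real.pi := by
    have := Real.pi_pos
    gcongr <;> linarith
  have b1 := h1 _ l1 l2
  have b2 := h2 ((Real.pi - x) * (Real.pi - y) + (1 / 4) ^ n) (by linarith) (by linarith)
  have e1 : ((1 / 4 : ℝ) ^ n) ^ (-(1 : ℝ) / 2) = 2 ^ n := by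
    rw [show (1 / 4 : ℝ) = 2 ^ (-2 : ℝ) by rw [Real.rpow_neg (by norm_num)]; norm_num,
      ← Real.rpow_natCast, ← Real.rpow_mul (by norm_num), ← Real.rpow_mul (by norm_num), ← Real.rpow_natCast]
    congr 1; ring
  have e2 : -c * (x - y) ^ 2 / (1 / 4) ^ n = -c * ((x - y) * 2 ^ n) ^ 2 := by
    rw [mul_pow, ← pow_mul, mul_comm n 2, pow_mul, one_div, inv_pow, div_inv_eq_mul]
    norm_num; ring
  unfold kk Kj
  rw [e1, e2]
  have hxy : 0 < x * y := by positivity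
  calc _ = ((Real.pi - x) * (Real.pi - y)) ^ p' * ((Real.pi - x) * (Real.pi - y) + (1 / 4) ^ n) ^ (-B - 1 / 2) *
      ((x * y) ^ p * (x * y + (1 / 4) ^ n) ^ (-A - 1 / 2) * 2 ^ n *
      Real.exp (-c * ((x - y) * 2 ^ n) ^ 2)) := by ring
    _ ≤ _ := by
      have := Real.pi_pos
      have l3 : 0 < (Real.pi - x) * (Real.pi - y) := lt_of_lt_of_le (by positivity) l1
      have l4 : 0 ≤ ((Real.pi - x) * (Real.pi - y) + (1 / 4) ^ n) ^ (-B - 1 / 2) := by positivity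
      gcongr

lemma ratio_bd (q : ℝ) : ∀ x y R s t : ℝ, 0 < x → 0 < y → 0 < s → 0 < t → t * s ^ 2 = 1 → 1 ≤ R * s →
    |x - y| ≤ R →
    (x * y + t) ^ (-q) * (x + R) ^ (2 * q) ≤ (9 * (R * s) ^ 2) ^ ⌈|q|⌉₊ := by
  intro x y R s t hx hy hs ht hts hRs hxy
  rw [abs_le] at hxy
  have hR : 0 < R := by
    by_contra h
    push Not at h
    nlinarith
  have hM : 1 ≤ (R * s) ^ 2 := one_le_pow₀ hRs
  have hv : 0 < x * y + t := by positivity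
  have hsq : t ≤ R ^ 2 := by
    have : t * (R * s) ^ 2 = R ^ 2 := by rw [mul_pow]; linear_combination R ^ 2 * hts
    nlinarith
  have hvu : x * y + t ≤ (x + R) ^ 2 := by nlinarith
  have key : ((x + R) ^ 2) ^ q ≤ (9 * (R * s) ^ 2) ^ |q| * (x * y + t) ^ q := by
    refine rpow_cmp _ _ _ _ hv (by linarith) ?_ ?_
    · refine le_trans (div_le_self hv.le (by linarith)) hvu
    · have e : 9 * (R * s) ^ 2 * (x * y + t) = 9 * ((R * s) ^ 2 * (x * y)) + 9 * R ^ 2 := by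
        linear_combination 9 * R ^ 2 * hts
      have hp : 0 < x * y := by positivity
      have h3 : x * y ≤ (R * s) ^ 2 * (x * y) := by nlinarith
      rw [e]
      rcases le_total (2 * R) x with h | h
      · nlinarith
      · nlinarith
  have e1 : (x + R) ^ (2 * q) = ((x + R) ^ 2) ^ q := by
    rw [Real.rpow_mul (by positivity)]; norm_cast
  rw [e1, Real.rpow_neg hv.le]
  have hvq : 0 < (x * y + t) ^ q := by positivity
  calc ((x * y + t) ^ q)⁻¹ * ((x + R) ^ 2) ^ q ≤ ((x * y + t) ^ q)⁻¹ * ((9 * (R * s) ^ 2) ^ |q| * (x * y + t) ^ q) := by gcongr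
    _ = (9 * (R * s) ^ 2) ^ |q| := by field_simp
    _ ≤ _ := by
      rw [← Real.rpow_natCast (9 * (R * s) ^ 2)]
      exact Real.rpow_le_rpow_of_exponent_le (x := 9 * (R * s) ^ 2) (by linarith) (Nat.le_ceil _)

lemma quarter (n : ℕ) : (1 / 4 : ℝ) ^ n * (2 ^ n) ^ 2 = 1 := by
  rw [← pow_mul, mul_comm n 2, pow_mul, ← mul_pow]; norm_num

lemma goodNE (c a b p' B : ℝ) (hc : 0 < c) (ha : -1 < a) :
    IsL c (mu1 a b) (kG c 0 p' a B (I0 ×ˢ I0)) := by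
  obtain ⟨C1, hC1, h1⟩ := kk_I0 c 0 p' a B hc
  obtain ⟨C2, hC2, h2⟩ := mu1_set a b
  obtain ⟨C3, hC3, h3⟩ := lint_ball a ha
  refine ⟨kG_meas _ _ _ _ _ _ (I0_meas.prod I0_meas), ?_⟩
  set m := ⌈|a + 1 / 2|⌉₊ with hm
  refine ⟨C1 * C2 * C3 * 9 ^ m, 2 * m + 1, fun j => if j = 0 then I0 else ∅, fun j => if j = 0 then I0 else ∅,
    by positivity, ?_, ?_, ?_, ?_, ?_, ?_⟩
  · intro j; dsimp only; split_ifs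
    · exact I0_meas
    · exact MeasurableSet.empty
  · intro j; dsimp only; split_ifs
    · exact I0_meas
    · exact MeasurableSet.empty
  · intro i j x hi hj
    by_cases h : i = 0 <;> by_cases h' : j = 0 <;> simp_all
  · intro i j x hi hj
    by_cases h : i = 0 <;> by_cases h' : j = 0 <;> simp_all
  · intro n x y hk
    refine ⟨0, ?_⟩
    unfold kG at hk
    by_cases h : (x, y) ∈ I0 ×ˢ I0
    · simpa using h
    · simp [h] at hk
  · intro n x y j R hx hy hR hxy
    by_cases h : j = 0
    swap
    · simp [h] at hx
    simp only [h, if_true] at hx hy ⊢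
    rw [Set.union_self]
    have hG : (x, y) ∈ I0 ×ˢ I0 := ⟨hx, hy⟩
    have hR0 : 0 < R := lt_of_lt_of_le (by positivity) hR
    have hRs : 1 ≤ R * 2 ^ n := by
      have : (1 / 2 : ℝ) ^ n * 2 ^ n = 1 := by rw [← mul_pow]; norm_num
      rw [← this]; gcongr
    have hr := ratio_bd (a + 1 / 2) x y R (2 ^ n) ((1 / 4) ^ n) hx.1 hy.1 (by positivity) (by positivity)
      (quarter n) hRs hxy
    have x1 := hx.1
    have y1 := hy.1
    have hms : mu1 a b (Metric.closedBall x R ∩ I0) ≤ ENNReal.ofReal C2 * ENNReal.ofReal (C3 * R * (x + R) ^ (2 * a + 1)) := by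
      refine (h2 _ Set.inter_subset_right (Metric.isClosed_closedBall.measurableSet.inter I0_meas)).trans ?_
      gcongr
      refine le_trans (lintegral_mono_set ?_) (h3 x R x1 hR0)
      exact Set.inter_subset_inter_right _ (fun u hu => hu.1)
    unfold kG
    rw [if_pos hG]
    refine (mul_le_mul' (ENNReal.ofReal_le_ofReal (h1 n x y hx hy)) hms).trans ?_
    have hxR : 0 < x + R := by positivity
    rw [← ENNReal.ofReal_mul hC2.le, ← ENNReal.ofReal_mul (by positivity)]
    refine ENNReal.ofReal_le_ofReal ?_
    rw [Real.rpow_zero, one_mul, show -a - 1 / 2 = -(a + 1 / 2) by ring, show 2 * a + 1 = 2 * (a + 1 / 2) by ring]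
    calc _ = C1 * C2 * C3 * ((x * y + (1 / 4) ^ n) ^ (-(a + 1 / 2)) * (x + R) ^ (2 * (a + 1 / 2))) * (R * 2 ^ n) *
          Real.exp (-c * ((x - y) * 2 ^ n) ^ 2) := by ring
      _ ≤ C1 * C2 * C3 * ((9 * (R * 2 ^ n) ^ 2) ^ m) * (R * 2 ^ n) *
          Real.exp (-c * ((x - y) * 2 ^ n) ^ 2) := by gcongr
      _ = _ := by rw [mul_pow, ← pow_mul, pow_succ]; ring

/-- dyadic pieces -/
def Pd (j : ℤ) : Set ℝ := I0 ∩ Set.Ico ((2 : ℝ) ^ j) ((2 : ℝ) ^ (j + 1))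

lemma Pd_meas (j : ℤ) : MeasurableSet (Pd j) := I0_meas.inter measurableSet_Ico

lemma Pd_disj (i j : ℤ) (x : ℝ) (hi : x ∈ Pd i) (hj : x ∈ Pd j) : i = j := by
  have h1 : (2 : ℝ) ^ i < 2 ^ (j + 1) := hi.2.1.trans_lt hj.2.2
  have h2 : (2 : ℝ) ^ j < 2 ^ (i + 1) := hj.2.1.trans_lt hi.2.2
  rw [zpow_lt_zpow_iff_right₀ (by norm_num)] at h1 h2
  omega

lemma Pd_ex (x : ℝ) (hx : x ∈ I0) : ∃ j, x ∈ Pd j := by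
  obtain ⟨j, hj⟩ := exists_mem_Ico_zpow (y := (2 : ℝ)) hx.1 (by norm_num)
  exact ⟨j, hx, hj⟩

lemma Pd_cmp (i j : ℤ) (x y : ℝ) (hx : x ∈ Pd i) (hy : y ∈ Pd j) (h : j ≤ i + 1) : y ≤ 4 * x := by
  have h1 := hx.2.1
  have h2 := hy.2.2
  have h3 : (2 : ℝ) ^ (j + 1) ≤ 2 ^ (i + 2) := zpow_le_zpow_right₀ (by norm_num) (by omega)
  rw [zpow_add₀ (a := (2 : ℝ)) (by norm_num) i 2] at h3
  norm_num at h3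
  linarith

lemma Pd_far (i j : ℤ) (x y : ℝ) (hx : x ∈ Pd i) (hy : y ∈ Pd j) (h : i + 2 ≤ j) : 2 * x ≤ y := by
  have h1 := hx.2.2
  have h2 := hy.2.1
  have h3 : (2 : ℝ) ^ (i + 2) ≤ 2 ^ j := zpow_le_zpow_right₀ (by norm_num) (by omega)
  rw [zpow_add₀ (by norm_num)] at h1 h3
  norm_num at h1 h3
  linarith

/-- near diagonal dyadic region -/
def Gd (s : ℤ) : Set (ℝ × ℝ) := ⋃ j : ℤ, Pd j ×ˢ Pd (j + s)

lemma Gd_meas (s : ℤ) : MeasurableSet (Gd s) := MeasurableSet.iUnion fun j => (Pd_meas j).prod (Pd_meas _)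

lemma loc_bd (A : ℝ) (hA : 0 < A) (x y t : ℝ) (hx : 0 < x) (hy : 0 < y) (ht : 0 < t) (h1 : y ≤ 4 * x) (h2 : x ≤ 4 * y) :
    (x * y) ^ (2 * A) * (x * y + t) ^ (-A - 1 / 2) ≤ 4 ^ |A - 1 / 2| * x ^ (2 * A - 1) := by
  have hp : 0 < x * y := by positivity
  calc (x * y) ^ (2 * A) * (x * y + t) ^ (-A - 1 / 2) ≤ (x * y) ^ (2 * A) * (x * y) ^ (-A - 1 / 2) := by
        gcongr (x * y) ^ (2 * A) * ?_
        exact Real.rpow_le_rpow_of_nonpos hp (by linarith) (by linarith)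
    _ = (x * y) ^ (A - 1 / 2) := by rw [← Real.rpow_add hp]; congr 1; ring
    _ ≤ 4 ^ |A - 1 / 2| * (x * x) ^ (A - 1 / 2) := by
        refine rpow_cmp _ _ _ _ (by positivity) (by norm_num) ?_ ?_ <;> nlinarith
    _ = _ := by
        rw [Real.mul_rpow hx.le hx.le, ← Real.rpow_add hx]; congr 2; ring

lemma goodLoc (c A b p' B : ℝ) (hc : 0 < c) (hA : 0 < A) (s : ℤ) (hs : |s| ≤ 1) :
    IsL c (mu1 (-A) b) (kG c (2 * A) p' A B (Gd s)) := by
  rw [abs_le] at hs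
  obtain ⟨C1, hC1, h1⟩ := kk_I0 c (2 * A) p' A B hc
  obtain ⟨C2, hC2, h2⟩ := mu1_set (-A) b
  refine ⟨kG_meas _ _ _ _ _ _ (Gd_meas s), ?_⟩
  refine ⟨C1 * 4 ^ |A - 1 / 2| * C2 * 2 * 4 ^ |2 * (-A) + 1|, 1, Pd, fun j => Pd (j + s),
    by positivity, Pd_meas, fun j => Pd_meas _, Pd_disj, ?_, ?_, ?_⟩
  · intro i j x hi hj
    have := Pd_disj _ _ _ hi hj
    omega
  · intro n x y hk
    unfold kG at hk
    by_cases h : (x, y) ∈ Gd s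
    · simpa [Gd] using h
    · simp [h] at hk
  · intro n x y j R hx hy hR hxy
    have hG : (x, y) ∈ Gd s := Set.mem_iUnion.2 ⟨j, hx, hy⟩
    have hR0 : 0 < R := lt_of_lt_of_le (by positivity) hR
    have x1 : 0 < x := hx.1.1
    have y1 : 0 < y := hy.1.1
    have hms : mu1 (-A) b (Metric.closedBall x R ∩ (Pd j ∪ Pd (j + s))) ≤
        ENNReal.ofReal C2 * ENNReal.ofReal (2 * R * (4 ^ |2 * (-A) + 1| * x ^ (2 * (-A) + 1))) := by
      have hm : MeasurableSet (Metric.closedBall x R ∩ (Pd j ∪ Pd (j + s))) :=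
        Metric.isClosed_closedBall.measurableSet.inter ((Pd_meas _).union (Pd_meas _))
      refine (h2 _ ?_ hm).trans ?_
      · rintro u ⟨-, hu | hu⟩ <;> exact hu.1
      gcongr
      refine lint_const_le _ x R _ Set.inter_subset_left hR0.le (by positivity) hm _ ?_
      rintro u ⟨-, hu | hu⟩
      · have := Pd_cmp _ _ _ _ hx hu (by omega)
        have := Pd_cmp _ _ _ _ hu hx (by omega)
        exact rpow_cmp _ _ _ _ x1 (by norm_num) (by linarith) (by linarith)
      · have := Pd_cmp _ _ _ _ hx hu (by omega)
        have := Pd_cmp _ _ _ _ hu hx (by omega)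
        exact rpow_cmp _ _ _ _ x1 (by norm_num) (by linarith) (by linarith)
    unfold kG
    rw [if_pos hG]
    refine (mul_le_mul' (ENNReal.ofReal_le_ofReal (h1 n x y hx.1 hy.1)) hms).trans ?_
    rw [← ENNReal.ofReal_mul hC2.le, ← ENNReal.ofReal_mul (by positivity)]
    refine ENNReal.ofReal_le_ofReal ?_
    have hl := loc_bd A hA x y ((1 / 4) ^ n) x1 y1 (by positivity) (Pd_cmp _ _ _ _ hx hy (by omega)) (Pd_cmp _ _ _ _ hy hx (by omega))
    have hxx : x ^ (2 * A - 1) * x ^ (2 * (-A) + 1) = 1 := by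
      rw [← Real.rpow_add x1]; ring_nf; exact Real.rpow_zero _
    calc _ = C1 * ((x * y) ^ (2 * A) * (x * y + (1 / 4) ^ n) ^ (-A - 1 / 2)) * C2 * 2 * 4 ^ |2 * (-A) + 1| * (R * 2 ^ n)
          * Real.exp (-c * ((x - y) * 2 ^ n) ^ 2) * x ^ (2 * (-A) + 1) := by ring
      _ ≤ C1 * (4 ^ |A - 1 / 2| * x ^ (2 * A - 1)) * C2 * 2 * 4 ^ |2 * (-A) + 1| * (R * 2 ^ n)
          * Real.exp (-c * ((x - y) * 2 ^ n) ^ 2) * x ^ (2 * (-A) + 1) := by gcongr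
      _ = _ := by linear_combination (C1 * 4 ^ |A - 1 / 2| * C2 * 2 * 4 ^ |2 * (-A) + 1| * (R * 2 ^ n)
          * Real.exp (-c * ((x - y) * 2 ^ n) ^ 2)) * hxx

lemma far_bd (c A : ℝ) (hc : 0 < c) (hA : 0 < A) : ∃ C : ℝ, 0 < C ∧ ∀ m M s t : ℝ, 0 < m → 2 * m ≤ M → 0 < s →
    0 < t → t * s ^ 2 = 1 →
    (m * M) ^ (2 * A) * (m * M + t) ^ (-A - 1 / 2) * s * Real.exp (-c * ((M - m) * s) ^ 2) ≤
      C * (m ^ (2 * A) * M ^ (-2 : ℝ)) := by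
  obtain ⟨B, hB, h⟩ := rpow_exp_bdd (A + 1) (c / 4) (by positivity) (by positivity)
  refine ⟨B, hB, fun m M s t hm hM hs ht hts => ?_⟩
  have hM0 : 0 < M := by linarith
  have hp : 0 < m * M := by positivity
  have h1 : (m * M + t) ^ (-A - 1 / 2) ≤ s ^ (2 * A + 1) := by
    have : t = s ^ (-2 : ℝ) := by
      rw [Real.rpow_neg hs.le]; norm_cast; field_simp; linarith
    calc (m * M + t) ^ (-A - 1 / 2) ≤ t ^ (-A - 1 / 2) :=
          Real.rpow_le_rpow_of_nonpos ht (by linarith) (by linarith)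
      _ = _ := by rw [this, ← Real.rpow_mul hs.le]; congr 1; ring
  have h2 : Real.exp (-c * ((M - m) * s) ^ 2) ≤ Real.exp (-(c / 4) * (M * s) ^ 2) := by
    rw [Real.exp_le_exp]
    have : (M / 2 * s) ^ 2 ≤ ((M - m) * s) ^ 2 := by gcongr; linarith
    nlinarith
  have h3 := h ((M * s) ^ 2) (by positivity)
  have e1 : ((M * s) ^ 2) ^ (A + 1) = M ^ (2 * A + 2) * s ^ (2 * A + 2) := by
    rw [← Real.mul_rpow hM0.le hs.le, ← Real.rpow_natCast, ← Real.rpow_mul (by positivity)]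
    congr 1; push_cast; ring
  have e2 : s ^ (2 * A + 1) * s = s ^ (2 * A + 2) := by
    rw [← Real.rpow_add_one hs.ne']; congr 1; ring
  have e3 : M ^ (2 * A) = M ^ (2 * A + 2) * M ^ (-2 : ℝ) := by
    rw [← Real.rpow_add hM0]; congr 1; ring
  rw [e1] at h3
  calc _ ≤ (m * M) ^ (2 * A) * s ^ (2 * A + 1) * s * Real.exp (-(c / 4) * (M * s) ^ 2) := by gcongr
    _ = m ^ (2 * A) * M ^ (-2 : ℝ) * (M ^ (2 * A + 2) * (s ^ (2 * A + 1) * s) * Real.exp (-(c / 4) * (M * s) ^ 2)) := by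
      rw [Real.mul_rpow hm.le hM0.le, e3]; ring
    _ ≤ m ^ (2 * A) * M ^ (-2 : ℝ) * B := by rw [e2]; gcongr
    _ = _ := by ring

lemma far_int (A y : ℝ) (hA : 0 < A) (hy : 0 < y) :
    ∫⁻ x in Set.Ioi 0, ENNReal.ofReal (x ^ (2 * (-A) + 1) * (min x y ^ (2 * A) * max x y ^ (-2 : ℝ))) ≤
      ENNReal.ofReal (1 + 1 / (2 * A)) := by
  rw [← Set.Ioc_union_Ioi_eq_Ioi hy.le, ENNReal.ofReal_add (by norm_num) (by positivity)]
  refine (lintegral_union_le _ _ _).trans (add_le_add ?_ ?_)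
  · calc _ ≤ ∫⁻ x in Set.Ioc 0 y, ENNReal.ofReal (1 / y) := by
          refine setLIntegral_mono' measurableSet_Ioc fun x hx => ENNReal.ofReal_le_ofReal ?_
          have hx0 := hx.1
          rw [min_eq_left hx.2, max_eq_right hx.2, ← mul_assoc, ← Real.rpow_add hx0]
          ring_nf
          rw [Real.rpow_one, Real.rpow_neg hy.le]
          norm_cast
          rw [← div_eq_mul_inv, div_le_iff₀ (by positivity), pow_two, inv_mul_cancel_left₀ hy.ne']
          exact hx.2
      _ = _ := by
          simp only [lintegral_const, Measure.restrict_apply MeasurableSet.univ, Set.univ_inter, Real.volume_Ioc]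
          rw [← ENNReal.ofReal_mul (by positivity)]
          congr 1
          field_simp
          simp
  · calc _ = ∫⁻ x in Set.Ioi y, ENNReal.ofReal (y ^ (2 * A) * x ^ (-1 - 2 * A)) := by
          refine setLIntegral_congr_fun measurableSet_Ioi fun x hx => ?_
          have hx' : y < x := hx
          have hx0 : 0 < x := hy.trans hx'
          rw [min_eq_right hx'.le, max_eq_left hx'.le, mul_left_comm, ← Real.rpow_add hx0]
          congr 3; ring
      _ = ENNReal.ofReal (∫ x in Set.Ioi y, y ^ (2 * A) * x ^ (-1 - 2 * A)) := by
          rw [ofReal_integral_eq_lintegral_ofReal]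
          · exact (integrableOn_Ioi_rpow_of_lt (by linarith) hy).const_mul _
          · filter_upwards [ae_restrict_mem measurableSet_Ioi] with x hx
            have : 0 < x := hy.trans hx
            positivity
      _ ≤ _ := by
          refine ENNReal.ofReal_le_ofReal (le_of_eq ?_)
          rw [integral_const_mul, integral_Ioi_rpow_of_lt (by linarith) hy]
          have e : (-1 - 2 * A + 1) = -(2 * A) := by ring
          rw [e, Real.rpow_neg hy.le]
          field_simp

lemma goodFar (c A b p' B : ℝ) (hc : 0 < c) (hA : 0 < A) (G : Set (ℝ × ℝ)) (hG : MeasurableSet G)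
    (hGs : ∀ z ∈ G, z.1 ∈ I0 ∧ z.2 ∈ I0 ∧ (2 * z.1 ≤ z.2 ∨ 2 * z.2 ≤ z.1)) :
    IsH (mu1 (-A) b) (kG c (2 * A) p' A B G) := by
  classical
  obtain ⟨C1, hC1, h1⟩ := kk_I0 c (2 * A) p' A B hc
  obtain ⟨C2, hC2, h2⟩ := far_bd c A hc hA
  obtain ⟨C3, hC3, h3⟩ := mu1_I0 (-A) b
  refine ⟨kG_meas _ _ _ _ _ _ hG, ?_⟩
  have hmm : Measurable fun z : ℝ × ℝ => if z ∈ I0 ×ˢ I0 then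
    ENNReal.ofReal (C1 * C2 * (min z.1 z.2 ^ (2 * A) * max z.1 z.2 ^ (-2 : ℝ))) else 0 := by
    refine Measurable.ite (I0_meas.prod I0_meas) ?_ measurable_const
    have : Measurable fun z : ℝ × ℝ => min z.1 z.2 := measurable_fst.min measurable_snd
    have : Measurable fun z : ℝ × ℝ => max z.1 z.2 := measurable_fst.max measurable_snd
    fun_prop
  refine ⟨fun x y => if (x, y) ∈ I0 ×ˢ I0 then
    ENNReal.ofReal (C1 * C2 * (min x y ^ (2 * A) * max x y ^ (-2 : ℝ))) else 0,
    ENNReal.ofReal (C3 * (C1 * C2) * (1 + 1 / (2 * A))), ENNReal.ofReal_ne_top, hmm, ?_, ?_⟩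
  · intro n x y
    unfold kG
    by_cases h : (x, y) ∈ G
    swap
    · simp [h]
    obtain ⟨hx, hy, hxy⟩ := hGs _ h
    dsimp only at hx hy hxy
    have hm : (x, y) ∈ I0 ×ˢ I0 := ⟨hx, hy⟩
    dsimp only
    rw [if_pos h, if_pos hm]
    refine ENNReal.ofReal_le_ofReal ((h1 n x y hx hy).trans ?_)
    rw [mul_assoc C1]
    refine mul_le_mul_of_nonneg_left ?_ hC1.le
    have x1 := hx.1
    have y1 := hy.1
    rcases hxy with hxy | hxy
    · have := h2 x y (2 ^ n) ((1 / 4) ^ n) x1 hxy (by positivity) (by positivity) (quarter n)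
      rw [min_eq_left (by linarith), max_eq_right (by linarith)]
      rwa [show ((x - y) * 2 ^ n) ^ 2 = ((y - x) * 2 ^ n) ^ 2 by ring]
    · have := h2 y x (2 ^ n) ((1 / 4) ^ n) y1 hxy (by positivity) (by positivity) (quarter n)
      rw [min_eq_right (by linarith), max_eq_left (by linarith)]
      rwa [mul_comm x y]
  · intro y
    by_cases hy : y ∈ I0
    swap
    · have : ∀ x, (x, y) ∉ I0 ×ˢ I0 := fun x h => hy h.2
      simp [this]
    have hmy : Measurable fun x : ℝ => if (x, y) ∈ I0 ×ˢ I0 then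
        ENNReal.ofReal (C1 * C2 * (min x y ^ (2 * A) * max x y ^ (-2 : ℝ))) else 0 :=
      hmm.comp (measurable_id.prodMk measurable_const)
    rw [mu1_lint _ _ _ hmy]
    calc _ ≤ ∫⁻ x in Set.Ioo 0 Real.pi, ENNReal.ofReal (C3 * (C1 * C2)) * ENNReal.ofReal (x ^ (2 * (-A) + 1) * (min x y ^ (2 * A) * max x y ^ (-2 : ℝ))) := by
          refine setLIntegral_mono' measurableSet_Ioo fun x hx => ?_
          by_cases h : x ∈ I0
          · have hm : (x, y) ∈ I0 ×ˢ I0 := ⟨h, hy⟩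
            rw [if_pos hm]
            have := hx.1
            have := hy.1
            have hmn : 0 < min x y := lt_min hx.1 hy.1
            have hmx : 0 < max x y := lt_max_of_lt_left hx.1
            refine (mul_le_mul_left (h3 x h) _).trans ?_
            rw [← ENNReal.ofReal_mul hC3.le, ← ENNReal.ofReal_mul (by positivity), ← ENNReal.ofReal_mul (by positivity)]
            refine ENNReal.ofReal_le_ofReal (le_of_eq ?_)
            ring
          · have hm : (x, y) ∉ I0 ×ˢ I0 := fun h' => h h'.1
            rw [if_neg hm]; simp
      _ ≤ ∫⁻ x in Set.Ioi 0, ENNReal.ofReal (C3 * (C1 * C2)) * ENNReal.ofReal (x ^ (2 * (-A) + 1) * (min x y ^ (2 * A) * max x y ^ (-2 : ℝ))) :=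
          lintegral_mono_set fun x hx => hx.1
      _ = ENNReal.ofReal (C3 * (C1 * C2)) * ∫⁻ x in Set.Ioi 0, ENNReal.ofReal (x ^ (2 * (-A) + 1) * (min x y ^ (2 * A) * max x y ^ (-2 : ℝ))) := by
          rw [lintegral_const_mul' _ _ ENNReal.ofReal_ne_top]
      _ ≤ ENNReal.ofReal (C3 * (C1 * C2)) * ENNReal.ofReal (1 + 1 / (2 * A)) := by
          gcongr; exact far_int A y hA hy.1
      _ = _ := by rw [← ENNReal.ofReal_mul (by positivity)]

/-- admissible one dimensional parameters -/
def Exo (a p A : ℝ) : Prop := (p = 0 ∧ A = a ∧ -1 < a) ∨ (p = -2 * a ∧ A = -a ∧ a < 0)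

lemma kG_le_add {c p p' A B : ℝ} {G G₁ G₂ : Set (ℝ × ℝ)} (h : G ⊆ G₁ ∪ G₂) (n : ℕ) (x y : ℝ) :
    kG c p p' A B G n x y ≤ kG c p p' A B G₁ n x y + kG c p p' A B G₂ n x y := by
  unfold kG
  by_cases hG : (x, y) ∈ G
  · rcases h hG with h | h
    · rw [if_pos hG, if_pos h]; exact le_self_add
    · rw [if_pos hG, if_pos h]; exact le_add_self
  · rw [if_neg hG]; exact zero_le

lemma goodI0 (c a b p p' A B : ℝ) (hc : 0 < c) (h : Exo a p A) :
    Good c (mu1 a b) (kG c p p' A B (I0 ×ˢ I0)) := by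
  rcases h with ⟨rfl, rfl, h⟩ | ⟨rfl, rfl, h⟩
  · exact Good.ofL (goodNE c A b p' B hc h)
  · obtain ⟨A, rfl⟩ : ∃ A, a = -A := ⟨-a, by ring⟩
    have hA : 0 < A := by linarith
    rw [show -2 * -A = 2 * A by ring, neg_neg]
    refine Good.add (Good.ofL (goodLoc c A b p' B hc hA 0 (by norm_num))) (Good.add (Good.ofL (goodLoc c A b p' B hc hA 1 (by norm_num)))
      (Good.add (Good.ofL (goodLoc c A b p' B hc hA (-1) (by norm_num))) (Good.ofH (goodFar c A b p' B hc hA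
        ((I0 ×ˢ I0) \ (Gd 0 ∪ (Gd 1 ∪ Gd (-1)))) ?_ ?_)) (kG_le_add (G := (I0 ×ˢ I0) \ (Gd 0 ∪ Gd 1)) ?_))
        (kG_le_add (G := (I0 ×ˢ I0) \ Gd 0) ?_)) (kG_le_add ?_)
    · exact (I0_meas.prod I0_meas).diff ((Gd_meas _).union ((Gd_meas _).union (Gd_meas _)))
    · rintro ⟨x, y⟩ ⟨⟨hx, hy⟩, hn⟩
      refine ⟨hx, hy, ?_⟩
      dsimp only at hx hy ⊢
      obtain ⟨i, hi⟩ := Pd_ex x hx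
      obtain ⟨j, hj⟩ := Pd_ex y hy
      have key : ∀ s : ℤ, (x, y) ∉ Gd s → j ≠ i + s := by
        rintro s hs rfl
        exact hs (Set.mem_iUnion.2 ⟨i, hi, hj⟩)
      simp only [Set.mem_union, not_or] at hn
      have k0 := key 0 hn.1
      have k1 := key 1 hn.2.1
      have k2 := key (-1) hn.2.2
      rcases le_total i j with h | h
      · exact Or.inl (Pd_far i j x y hi hj (by omega))
      · exact Or.inr (Pd_far j i y x hj hi (by omega))
    · intro z hz
      by_cases h : z ∈ Gd (-1) <;> simp_all
    · intro z hz
      by_cases h : z ∈ Gd 1 <;> simp_all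
    · intro z hz
      by_cases h : z ∈ Gd 0 <;> simp_all

lemma lint_refl (f : ℝ → ℝ≥0∞) :
    ∫⁻ x in Set.Ioo 0 Real.pi, f (Real.pi - x) = ∫⁻ x in Set.Ioo 0 Real.pi, f x := by
  rw [← lintegral_indicator measurableSet_Ioo, ← lintegral_indicator measurableSet_Ioo,
    ← lintegral_sub_left_eq_self _ Real.pi]
  refine lintegral_congr fun x => ?_
  by_cases h : x ∈ Set.Ioo 0 Real.pi
  · have h' : Real.pi - x ∈ Set.Ioo 0 Real.pi := ⟨by linarith [h.2], by linarith [h.1]⟩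
    rw [Set.indicator_of_mem h, Set.indicator_of_mem h', sub_sub_cancel]
  · have h' : Real.pi - x ∉ Set.Ioo 0 Real.pi := fun h' => h ⟨by linarith [h'.2], by linarith [h'.1]⟩
    rw [Set.indicator_of_notMem h, Set.indicator_of_notMem h']

lemma refl_mp (a b : ℝ) : MeasurePreserving (fun x : ℝ => Real.pi - x) (mu1 b a) (mu1 a b) := by
  have hm : Measurable (fun x : ℝ => Real.pi - x) := by fun_prop
  refine ⟨hm, ?_⟩
  ext S hS
  rw [Measure.map_apply hm hS, ← lintegral_indicator_one hS, ← lintegral_indicator_one (hm hS),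
    mu1_lint _ _ _ (measurable_one.indicator hS), mu1_lint _ _ _ (measurable_one.indicator (hm hS)), ← lint_refl]
  refine lintegral_congr fun x => ?_
  rw [sub_sub_cancel, mul_comm (x ^ _)]
  congr 1
  have h : (Real.pi - x) ∈ (fun x => Real.pi - x) ⁻¹' S ↔ x ∈ S := by
    rw [Set.mem_preimage, sub_sub_cancel]
  by_cases hx : x ∈ S
  · rw [Set.indicator_of_mem hx, Set.indicator_of_mem (h.2 hx)]; rfl
  · rw [Set.indicator_of_notMem hx, Set.indicator_of_notMem (fun h1 => hx (h.1 h1))]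

lemma refl_L {c a b : ℝ} {k : ℕ → ℝ → ℝ → ℝ≥0∞} (h : IsL c (mu1 b a) k) :
    IsL c (mu1 a b) (fun n x y => k n (Real.pi - x) (Real.pi - y)) := by
  obtain ⟨hk, C, D, P, Q, hC, hP, hQ, dP, dQ, hs, hb⟩ := h
  have hm : Measurable (fun x : ℝ => Real.pi - x) := by fun_prop
  refine ⟨fun n => (hk n).comp (f := fun z : ℝ × ℝ => (Real.pi - z.1, Real.pi - z.2)) (by fun_prop), C, D,
    fun j => (fun x => Real.pi - x) ⁻¹' P j, fun j => (fun x => Real.pi - x) ⁻¹' Q j, hC, fun j => hm (hP j),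
    fun j => hm (hQ j), fun i j x => dP i j _, fun i j x => dQ i j _, fun n x y => hs n _ _, ?_⟩
  intro n x y j R hx hy hR hxy
  have hxy' : |Real.pi - x - (Real.pi - y)| ≤ R := by
    rw [show Real.pi - x - (Real.pi - y) = -(x - y) by ring, abs_neg]; exact hxy
  have := hb n _ _ j R hx hy hR hxy'
  rw [← (refl_mp a b).measure_preimage]
  · rw [show (Real.pi - x - (Real.pi - y)) * 2 ^ n = - ((x - y) * 2 ^ n) by ring, neg_sq] at this
    convert this using 3
    ext u
    simp only [Set.mem_preimage, Set.mem_inter_iff, Metric.mem_closedBall, Real.dist_eq, Set.mem_union, sub_sub_cancel]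
    rw [show Real.pi - u - x = -(u - (Real.pi - x)) by ring, abs_neg]
  · exact (Metric.isClosed_closedBall.measurableSet.inter ((hm (hP j)).union (hm (hQ j)))).nullMeasurableSet

lemma refl_H {a b : ℝ} {k : ℕ → ℝ → ℝ → ℝ≥0∞} (h : IsH (mu1 b a) k) :
    IsH (mu1 a b) (fun n x y => k n (Real.pi - x) (Real.pi - y)) := by
  obtain ⟨hk, H, C, hC, hH, hle, hi⟩ := h
  have hm2 : Measurable fun z : ℝ × ℝ => (Real.pi - z.1, Real.pi - z.2) := by fun_prop
  refine ⟨fun n => (hk n).comp hm2, fun x y => H (Real.pi - x) (Real.pi - y), C, hC, hH.comp hm2,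
    fun n x y => hle n _ _, fun y => ?_⟩
  have hHy : Measurable fun x => H x (Real.pi - y) := hH.comp (measurable_id.prodMk measurable_const)
  rw [(refl_mp b a).lintegral_comp hHy]
  exact hi _

lemma refl_Good {c a b : ℝ} {k : ℕ → ℝ → ℝ → ℝ≥0∞} (h : Good c (mu1 b a) k) :
    Good c (mu1 a b) (fun n x y => k n (Real.pi - x) (Real.pi - y)) := by
  obtain ⟨m, q, hq, hk⟩ := h
  refine ⟨m, fun j n x y => q j n (Real.pi - x) (Real.pi - y), fun j => ?_, fun n x y => hk n _ _⟩
  rcases hq j with h | h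
  · exact Or.inl (refl_L h)
  · exact Or.inr (refl_H h)

lemma kk_refl (c p p' A B t x y : ℝ) :
    kk c p' p B A t (Real.pi - x) (Real.pi - y) = kk c p p' A B t x y := by
  unfold kk Kj
  rw [sub_sub_cancel, sub_sub_cancel, show (Real.pi - x - (Real.pi - y)) ^ 2 = (x - y) ^ 2 by ring]
  ring

lemma lint_rpow_fin (w : ℝ) (hw : -1 < w) :
    ∫⁻ x in Set.Ioo 0 Real.pi, ENNReal.ofReal (x ^ w) ≠ ∞ := by
  have h1 : ∫⁻ x in Set.Ioo 0 Real.pi, ENNReal.ofReal (x ^ w) ≤ ∫⁻ x in Set.Ioc 0 Real.pi, ENNReal.ofReal (x ^ w) :=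
    lintegral_mono_set Set.Ioo_subset_Ioc_self
  rw [lint_rpow w _ hw Real.pi_pos.le] at h1
  exact ne_top_of_le_ne_top ENNReal.ofReal_ne_top h1

lemma beta_fin (w w' : ℝ) (hw : -1 < w) (hw' : -1 < w') :
    ∫⁻ x in Set.Ioo 0 Real.pi, ENNReal.ofReal (x ^ w * (Real.pi - x) ^ w') ≠ ∞ := by
  have hpi := Real.pi_pos
  obtain ⟨C1, hC1, h1⟩ := rpow_bdd (Real.pi / 2) Real.pi w' (by positivity)
  obtain ⟨C2, hC2, h2⟩ := rpow_bdd (Real.pi / 2) Real.pi w (by positivity)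
  have hle : ∫⁻ x in Set.Ioo 0 Real.pi, ENNReal.ofReal (x ^ w * (Real.pi - x) ^ w') ≤
      ∫⁻ x in Set.Ioo 0 Real.pi, (ENNReal.ofReal C1 * ENNReal.ofReal (x ^ w) + ENNReal.ofReal C2 * ENNReal.ofReal ((Real.pi - x) ^ w')) := by
    refine setLIntegral_mono' measurableSet_Ioo fun x hx => ?_
    have x1 := hx.1
    have x2 : 0 < Real.pi - x := by linarith [hx.2]
    rw [← ENNReal.ofReal_mul hC1.le, ← ENNReal.ofReal_mul hC2.le]
    rcases le_total x (Real.pi / 2) with h | h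
    · refine le_trans (ENNReal.ofReal_le_ofReal ?_) le_self_add
      rw [mul_comm]
      gcongr
      exact h1 _ (by linarith) (by linarith)
    · refine le_trans (ENNReal.ofReal_le_ofReal ?_) le_add_self
      gcongr
      exact h2 _ (by linarith) (by linarith)
  refine ne_top_of_le_ne_top ?_ hle
  rw [lintegral_add_left (by fun_prop), lintegral_const_mul' _ _ ENNReal.ofReal_ne_top, lintegral_const_mul' _ _ ENNReal.ofReal_ne_top,
    lint_refl (fun x => ENNReal.ofReal (x ^ w'))]
  exact ENNReal.add_ne_top.2 ⟨ENNReal.mul_ne_top ENNReal.ofReal_ne_top (lint_rpow_fin w hw),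
    ENNReal.mul_ne_top ENNReal.ofReal_ne_top (lint_rpow_fin w' hw')⟩

lemma Kj_rest (c A B : ℝ) (hc : 0 < c) : ∃ C : ℝ, 0 < C ∧ ∀ t x y : ℝ, 0 < t → t ≤ 1 → x ∈ Set.Ioo 0 Real.pi →
    y ∈ Set.Ioo 0 Real.pi → Real.pi / 3 ≤ |x - y| → Kj c A B t x y ≤ C := by
  have hpi := Real.pi_pos
  set L : ℝ := Real.pi * Real.pi + 1 with hL
  have hL1 : 1 ≤ L := by nlinarith
  have hL0 : 0 < L := by linarith
  obtain ⟨K, hK, h⟩ := rpow_exp_bdd (|-A - 1 / 2| + |-B - 1 / 2| + 1 / 2) (c * (Real.pi / 3) ^ 2 / L) (by positivity) (by positivity)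
  refine ⟨K, hK, fun t x y ht ht1 hx hy hxy => ?_⟩
  have x1 := hx.1
  have x2 : 0 < Real.pi - x := by linarith [hx.2]
  have y1 := hy.1
  have y2 : 0 < Real.pi - y := by linarith [hy.2]
  set M := L / t with hM
  have hM0 : 0 < M := by positivity
  have hLM : L ≤ M := by rw [hM, le_div_iff₀ ht]; nlinarith
  have aux : ∀ u e : ℝ, 0 < u → u ≤ Real.pi * Real.pi → (u + t) ^ e ≤ M ^ |e| := by
    intro u e hu hu1
    have := rpow_cmp (u + t) 1 M e one_pos (by linarith) ?_ (by linarith)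
    · simpa using this
    · rw [hM, one_div_div, div_le_iff₀ hL0]; nlinarith
  have b1 := aux (x * y) (-A - 1 / 2) (by positivity) (by gcongr <;> linarith)
  have b2 := aux ((Real.pi - x) * (Real.pi - y)) (-B - 1 / 2) (by positivity) (by gcongr <;> linarith)
  have b3 : t ^ (-(1 : ℝ) / 2) ≤ M ^ (1 / 2 : ℝ) := by
    rw [neg_div, Real.rpow_neg ht.le, ← Real.inv_rpow ht.le]
    refine Real.rpow_le_rpow (by positivity) ?_ (by norm_num)
    rw [hM, inv_eq_one_div]; gcongr
  have b4 : Real.exp (-c * (x - y) ^ 2 / t) ≤ Real.exp (-(c * (Real.pi / 3) ^ 2 / L) * M) := by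
    rw [Real.exp_le_exp, hM]
    have : -(c * (Real.pi / 3) ^ 2 / L) * (L / t) = -c * (Real.pi / 3) ^ 2 / t := by field_simp
    rw [this]
    have h5 : (Real.pi / 3) ^ 2 ≤ (x - y) ^ 2 := by rw [← sq_abs (x - y)]; gcongr
    gcongr ?_ / t
    nlinarith
  refine le_trans ?_ (h M hM0.le)
  unfold Kj
  rw [Real.rpow_add hM0, Real.rpow_add hM0]
  have : 0 < (Real.pi - x) * (Real.pi - y) := by positivity
  gcongr

lemma Exo.nonneg {a p A : ℝ} (h : Exo a p A) : 0 ≤ p ∧ -1 < p + (2 * a + 1) := by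
  rcases h with ⟨h1, h2, h3⟩ | ⟨h1, h2, h3⟩
  · rw [h1]; constructor <;> linarith
  · rw [h1]; constructor <;> linarith

/-- off diagonal region -/
def Grest : Set (ℝ × ℝ) := (Set.Ioo 0 Real.pi ×ˢ Set.Ioo 0 Real.pi) ∩ {z | Real.pi / 3 ≤ |z.1 - z.2|}

lemma goodRest (c a b p p' A B : ℝ) (hc : 0 < c) (h : Exo a p A) (h' : Exo b p' B) :
    IsH (mu1 a b) (kG c p p' A B Grest) := by
  classical
  have hpi := Real.pi_pos
  obtain ⟨C, hC, hK⟩ := Kj_rest c A B hc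
  have hI : MeasurableSet (Set.Ioo 0 Real.pi ×ˢ Set.Ioo 0 Real.pi) := measurableSet_Ioo.prod measurableSet_Ioo
  have hG : MeasurableSet Grest := hI.inter (measurableSet_le measurable_const (by fun_prop))
  refine ⟨kG_meas _ _ _ _ _ _ hG, ?_⟩
  set K : ℝ := Real.pi ^ p * Real.pi ^ p' * C with hKd
  have hmx : Measurable fun x : ℝ => ENNReal.ofReal (K * (x ^ p * (Real.pi - x) ^ p')) := by fun_prop
  refine ⟨fun x _ => ENNReal.ofReal (K * (x ^ p * (Real.pi - x) ^ p')) + if x ∈ Set.Ioo 0 Real.pi then 0 else ∞,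
    ∫⁻ x, ENNReal.ofReal (K * (x ^ p * (Real.pi - x) ^ p')) ∂(mu1 a b), ?_, ?_, ?_, ?_⟩
  · rw [mu1_lint _ _ _ hmx]
    have e : ∫⁻ x in Set.Ioo 0 Real.pi, ENNReal.ofReal (x ^ (2 * a + 1) * (Real.pi - x) ^ (2 * b + 1)) * ENNReal.ofReal (K * (x ^ p * (Real.pi - x) ^ p'))
      = ∫⁻ x in Set.Ioo 0 Real.pi, ENNReal.ofReal K * ENNReal.ofReal (x ^ (p + (2 * a + 1)) * (Real.pi - x) ^ (p' + (2 * b + 1))) := by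
      refine setLIntegral_congr_fun measurableSet_Ioo fun x hx => ?_
      have x1 := hx.1
      have x2 : 0 < Real.pi - x := by linarith [hx.2]
      rw [← ENNReal.ofReal_mul (by positivity), ← ENNReal.ofReal_mul (by positivity), Real.rpow_add x1 p (2 * a + 1), Real.rpow_add x2 p' (2 * b + 1)]
      congr 1
      ring
    rw [e, lintegral_const_mul' _ _ ENNReal.ofReal_ne_top]
    exact ENNReal.mul_ne_top ENNReal.ofReal_ne_top (beta_fin _ _ h.nonneg.2 h'.nonneg.2)
  · refine (hmx.comp measurable_fst).add ?_
    exact Measurable.ite (measurable_fst measurableSet_Ioo) measurable_const measurable_const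
  · intro n x y
    unfold kG
    by_cases hz : (x, y) ∈ Grest
    swap
    · simp [hz]
    rw [if_pos hz]
    refine le_trans (ENNReal.ofReal_le_ofReal ?_) le_self_add
    have hx : x ∈ Set.Ioo 0 Real.pi := hz.1.1
    have hy : y ∈ Set.Ioo 0 Real.pi := hz.1.2
    have x1 := hx.1
    have x2 : 0 < Real.pi - x := by linarith [hx.2]
    have y1 := hy.1
    have y2 : 0 < Real.pi - y := by linarith [hy.2]
    have hk := hK ((1 / 4) ^ n) x y (by positivity) (pow_le_one₀ (by norm_num) (by norm_num)) hx hy hz.2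
    unfold kk
    have hp := h.nonneg.1
    have hp' := h'.nonneg.1
    have b1 : (x * y) ^ p ≤ x ^ p * Real.pi ^ p := by
      rw [Real.mul_rpow x1.le y1.le]; gcongr; exact hy.2.le
    have b2 : ((Real.pi - x) * (Real.pi - y)) ^ p' ≤ (Real.pi - x) ^ p' * Real.pi ^ p' := by
      rw [Real.mul_rpow x2.le y2.le]; gcongr; linarith
    have hkn : 0 ≤ Kj c A B ((1 / 4) ^ n) x y := by
      have : 0 < x * y := by positivity
      have : 0 < (Real.pi - x) * (Real.pi - y) := by positivity
      unfold Kj; positivity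
    calc _ ≤ (x ^ p * Real.pi ^ p) * ((Real.pi - x) ^ p' * Real.pi ^ p') * C := by gcongr
      _ = _ := by rw [hKd]; ring
  · intro y
    refine le_of_eq (lintegral_congr_ae ?_)
    have : ∀ᵐ x ∂(mu1 a b), x ∈ Set.Ioo 0 Real.pi := by
      unfold mu1
      exact ae_restrict_mem measurableSet_Ioo
    filter_upwards [this] with x hx
    rw [if_pos hx, add_zero]

lemma good1 (c a b p p' A B : ℝ) (hc : 0 < c) (h : Exo a p A) (h' : Exo b p' B) :
    Good c (mu1 a b) (kG c p p' A B (Set.Ioo 0 Real.pi ×ˢ Set.Ioo 0 Real.pi)) := by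
  have g1 := goodI0 c a b p p' A B hc h
  have g2 : Good c (mu1 a b) (kG c p p' A B ((fun z : ℝ × ℝ => (Real.pi - z.1, Real.pi - z.2)) ⁻¹' (I0 ×ˢ I0))) := by
    have := refl_Good (goodI0 c b a p' p B A hc h')
    convert this using 4 with n x y
    unfold kG
    rw [kk_refl]
    rfl
  have g3 := Good.ofH (c := c) (goodRest c a b p p' A B hc h h')
  refine Good.add g1 (Good.add g2 g3 (kG_le_add subset_rfl)) (kG_le_add ?_)
  rintro ⟨x, y⟩ ⟨⟨x1, x2⟩, ⟨y1, y2⟩⟩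
  dsimp only at x1 x2 y1 y2
  simp only [Set.mem_union, Set.mem_prod, Set.mem_preimage, I0, Set.mem_Ioo, Grest, Set.mem_inter_iff, Set.mem_ofPred_eq, le_abs]
  by_contra hcon
  push Not at hcon
  obtain ⟨a1, a2, a3⟩ := hcon
  have a3 := a3 ⟨⟨x1, x2⟩, ⟨y1, y2⟩⟩
  rcases lt_or_ge x (2 * Real.pi / 3) with hx | hx
  · have hy := a1 ⟨x1, hx⟩ y1
    have := a2 ⟨by linarith, by linarith⟩ (by linarith)
    linarith
  · have hy := a2 ⟨by linarith, by linarith⟩ (by linarith)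
    linarith

lemma etaM_eq (d : ℕ) (α β : Fin d → ℝ) : etaM d α β = Measure.pi (fun i => mu1 (α i) (β i)) := by
  classical
  symm
  refine Measure.pi_eq fun s hs => ?_
  set g : Fin d → ℝ → ℝ≥0∞ := fun i => (s i ∩ Set.Ioo 0 Real.pi).indicator fun x =>
    ENNReal.ofReal (x ^ (2 * α i + 1) * (Real.pi - x) ^ (2 * β i + 1)) with hg
  have hmi : ∀ i, MeasurableSet (s i ∩ Set.Ioo 0 Real.pi) := fun i => (hs i).inter measurableSet_Ioo
  have hgm : ∀ i, Measurable (g i) := fun i => (dens_meas _ _).indicator (hmi i)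
  have hcube : {θ : Fin d → ℝ | ∀ i, 0 < θ i ∧ θ i < Real.pi} = Set.univ.pi fun _ => Set.Ioo 0 Real.pi := by
    ext θ; simp
  have hinter : Set.univ.pi s ∩ {θ : Fin d → ℝ | ∀ i, 0 < θ i ∧ θ i < Real.pi} = Set.univ.pi fun i => s i ∩ Set.Ioo 0 Real.pi := by
    rw [hcube, Set.pi_inter_distrib]
  have hms : MeasurableSet (Set.univ.pi s) := MeasurableSet.univ_pi hs
  have hmI : MeasurableSet (Set.univ.pi fun i => s i ∩ Set.Ioo 0 Real.pi) := MeasurableSet.univ_pi hmi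
  unfold etaM
  rw [Measure.restrict_apply hms, hinter, withDensity_apply _ hmI, ← lintegral_indicator hmI]
  have e1 : ∀ i, mu1 (α i) (β i) (s i) = ∫⁻ x, g i x := by
    intro i
    unfold mu1
    rw [Measure.restrict_apply (hs i), withDensity_apply _ (hmi i), ← lintegral_indicator (hmi i)]
  rw [Finset.prod_congr rfl fun i _ => e1 i, ← lintegral_pi_prod (fun _ => volume) g hgm, volume_pi]
  refine lintegral_congr fun θ => ?_
  by_cases h : θ ∈ Set.univ.pi fun i => s i ∩ Set.Ioo 0 Real.pi
  · rw [Set.indicator_of_mem h, ENNReal.ofReal_prod_of_nonneg]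
    · refine Finset.prod_congr rfl fun i _ => ?_
      rw [hg]
      dsimp only
      rw [Set.indicator_of_mem (h i (Set.mem_univ i))]
    · intro i _
      have h1 := (h i (Set.mem_univ i)).2
      have := h1.1
      have : 0 < Real.pi - θ i := by linarith [h1.2]
      positivity
  · rw [Set.indicator_of_notMem h]
    simp only [Set.mem_pi, Set.mem_univ, true_imp_iff, not_forall] at h
    obtain ⟨i, hi⟩ := h
    symm
    refine Finset.prod_eq_zero (Finset.mem_univ i) ?_
    rw [hg]
    dsimp only
    rw [Set.indicator_of_notMem hi]

lemma kk_nonneg (c p p' A B t x y : ℝ) (ht : 0 < t) (hx : x ∈ Set.Ioo 0 Real.pi) (hy : y ∈ Set.Ioo 0 Real.pi) :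
    0 ≤ kk c p p' A B t x y := by
  have x1 := hx.1
  have x2 : 0 < Real.pi - x := by linarith [hx.2]
  have y1 := hy.1
  have y2 : 0 < Real.pi - y := by linarith [hy.2]
  have : 0 < x * y := by positivity
  have : 0 < (Real.pi - x) * (Real.pi - y) := by positivity
  unfold kk Kj
  positivity

lemma kk_disc (c p p' A B : ℝ) (hc : 0 < c) : ∃ C : ℝ, 0 < C ∧ ∀ t T x y : ℝ, 0 < t → t ≤ T → T ≤ 4 * t →
    x ∈ Set.Ioo 0 Real.pi → y ∈ Set.Ioo 0 Real.pi → kk c p p' A B t x y ≤ C * kk c p p' A B T x y := by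
  refine ⟨4 ^ |-A - 1 / 2| * 4 ^ |-B - 1 / 2| * 4 ^ |-(1 : ℝ) / 2|, by positivity, fun t T x y ht h1 h2 hx hy => ?_⟩
  have x1 := hx.1
  have x2 : 0 < Real.pi - x := by linarith [hx.2]
  have y1 := hy.1
  have y2 : 0 < Real.pi - y := by linarith [hy.2]
  have hT : 0 < T := by linarith
  have p1 : 0 < x * y := by positivity
  have p2 : 0 < (Real.pi - x) * (Real.pi - y) := by positivity
  have b1 := rpow_cmp (x * y + t) (x * y + T) 4 (-A - 1 / 2) (by positivity) (by norm_num) (by linarith) (by linarith)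
  have b2 := rpow_cmp ((Real.pi - x) * (Real.pi - y) + t) ((Real.pi - x) * (Real.pi - y) + T) 4 (-B - 1 / 2) (by positivity) (by norm_num) (by linarith) (by linarith)
  have b3 := rpow_cmp t T 4 (-(1 : ℝ) / 2) hT (by norm_num) (by linarith) (by linarith)
  have b4 : Real.exp (-c * (x - y) ^ 2 / t) ≤ Real.exp (-c * (x - y) ^ 2 / T) := by
    rw [Real.exp_le_exp, neg_mul, neg_div, neg_div, neg_le_neg_iff]
    gcongr
  unfold kk Kj
  calc _ ≤ (x * y) ^ p * ((Real.pi - x) * (Real.pi - y)) ^ p' * ((4 ^ |-A - 1 / 2| * (x * y + T) ^ (-A - 1 / 2)) *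
      (4 ^ |-B - 1 / 2| * ((Real.pi - x) * (Real.pi - y) + T) ^ (-B - 1 / 2)) * (4 ^ |-(1 : ℝ) / 2| * T ^ (-(1 : ℝ) / 2)) *
      Real.exp (-c * (x - y) ^ 2 / T)) := by gcongr
    _ = _ := by ring

lemma exists_scale (t : ℝ) (ht : 0 < t) (ht1 : t ≤ 1) : ∃ n : ℕ, t ≤ (1 / 4) ^ n ∧ (1 / 4) ^ n ≤ 4 * t := by
  obtain ⟨n, h1, h2⟩ := exists_nat_pow_near_of_lt_one ht ht1 (y := (1 / 4 : ℝ)) (by norm_num) (by norm_num)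
  refine ⟨n, h2, ?_⟩
  rw [pow_succ] at h1
  linarith

/-- For `d ≥ 1`, `E, F ⊂ {1,…,d}`, `α ∈ A(E)`, `β ∈ A(F)` with
`m_E(α) < 0` and `m_F(β) < 0`, the maximal operator
`𝕂_*^{(α,E),(β,F)} f(θ) = sup_{0<t≤1} ∫ 𝕂_t^{(α,E),(β,F)}(θ,φ) f(φ) dη_{α,β}(φ)`
is of weak type `(1,1)` with respect to `η_{α,β}`. -/
theorem stmt17 (d : ℕ) (hd : 1 ≤ d) (c₂ : ℝ) (hc₂ : 0 < c₂) (E F : Finset (Fin d))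
    (α β : Fin d → ℝ)
    (hαE : ∀ i ∈ E, α i ≠ 0 ∧ α i < 1) (hαEc : ∀ i ∉ E, -1 < α i)
    (hβF : ∀ i ∈ F, β i ≠ 0 ∧ β i < 1) (hβFc : ∀ i ∉ F, -1 < β i)
    (hmE : ∀ i ∈ E, α i < 0) (hmF : ∀ i ∈ F, β i < 0) :
    ∃ C : ℝ, 0 < C ∧ ∀ f : (Fin d → ℝ) → ℝ, (∀ θ, 0 ≤ f θ) →
      Integrable f (etaM d α β) → ∀ lam : ℝ, 0 < lam →
      etaM d α β {θ | ENNReal.ofReal lam <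
          ⨆ t ∈ Set.Ioc (0 : ℝ) 1,
            ∫⁻ φ, ENNReal.ofReal (KKj d c₂ E F α β t θ φ * f φ) ∂(etaM d α β)} ≤
        ENNReal.ofReal (C / lam * ∫ θ, f θ ∂(etaM d α β)) := by
  classical
  set p : Fin d → ℝ := fun i => if i ∈ E then -2 * α i else 0 with hp
  set p' : Fin d → ℝ := fun i => if i ∈ F then -2 * β i else 0 with hp'
  set A : Fin d → ℝ := fun i => if i ∈ E then -α i else α i with hA
  set B : Fin d → ℝ := fun i => if i ∈ F then -β i else β i with hB
  have hEx : ∀ i, Exo (α i) (p i) (A i) := by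
    intro i
    by_cases h : i ∈ E
    · exact Or.inr ⟨by simp [hp, h], by simp [hA, h], hmE i h⟩
    · exact Or.inl ⟨by simp [hp, h], by simp [hA, h], hαEc i h⟩
  have hEx' : ∀ i, Exo (β i) (p' i) (B i) := by
    intro i
    by_cases h : i ∈ F
    · exact Or.inr ⟨by simp [hp', h], by simp [hB, h], hmF i h⟩
    · exact Or.inl ⟨by simp [hp', h], by simp [hB, h], hβFc i h⟩
  obtain ⟨C, hC, hweak⟩ := weakGood c₂ hc₂ (fun i => mu1 (α i) (β i))
    (fun i => kG c₂ (p i) (p' i) (A i) (B i) (Set.Ioo 0 Real.pi ×ˢ Set.Ioo 0 Real.pi))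
    (fun i => good1 c₂ _ _ _ _ _ _ hc₂ (hEx i) (hEx' i))
  rw [← etaM_eq] at hweak
  have hdisc := fun i => kk_disc c₂ (p i) (p' i) (A i) (B i) hc₂
  choose Ki hKi hdisc using hdisc
  set K : ℝ := ∏ i, Ki i with hK
  have hK0 : 0 < K := Finset.prod_pos fun i _ => hKi i
  have hcube : ∀ᵐ θ ∂(etaM d α β), ∀ i, θ i ∈ Set.Ioo 0 Real.pi := by
    have hm : MeasurableSet {θ : Fin d → ℝ | ∀ i, 0 < θ i ∧ θ i < Real.pi} := by measurability
    unfold etaM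
    filter_upwards [ae_restrict_mem hm] with θ hθ i
    exact hθ i
  refine ⟨K * C.toReal + 1, by positivity, fun f hf0 hf lam hlam => ?_⟩
  set g := hf.aestronglyMeasurable.mk f with hg
  have hgm : Measurable g := hf.aestronglyMeasurable.stronglyMeasurable_mk.measurable
  have hfg : f =ᵐ[etaM d α β] g := hf.aestronglyMeasurable.ae_eq_mk
  have hw := hweak (fun φ => ENNReal.ofReal (g φ)) (by fun_prop) (ENNReal.ofReal (lam / K))
  have hI0 : 0 ≤ ∫ θ, f θ ∂(etaM d α β) := integral_nonneg hf0
  have hI : ∫⁻ φ, ENNReal.ofReal (g φ) ∂(etaM d α β) = ENNReal.ofReal (∫ θ, f θ ∂(etaM d α β)) := by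
    rw [ofReal_integral_eq_lintegral_ofReal hf (Filter.Eventually.of_forall hf0)]
    refine lintegral_congr_ae ?_
    filter_upwards [hfg] with φ h
    rw [h]
  rw [hI] at hw
  have hmono : etaM d α β {θ | ENNReal.ofReal lam <
          ⨆ t ∈ Set.Ioc (0 : ℝ) 1,
            ∫⁻ φ, ENNReal.ofReal (KKj d c₂ E F α β t θ φ * f φ) ∂(etaM d α β)} ≤
      etaM d α β {x | ENNReal.ofReal (lam / K) < ⨆ n, ∫⁻ y, (∏ i, kG c₂ (p i) (p' i) (A i) (B i)
        (Set.Ioo 0 Real.pi ×ˢ Set.Ioo 0 Real.pi) n (x i) (y i)) * ENNReal.ofReal (g y) ∂(etaM d α β)} := by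
    refine measure_mono_ae ?_
    filter_upwards [hcube] with θ hθ hlt
    change ENNReal.ofReal lam < _ at hlt
    change ENNReal.ofReal (lam / K) < _
    simp only [lt_iSup_iff] at hlt ⊢
    obtain ⟨t, ht, hlt⟩ := hlt
    obtain ⟨n, hn1, hn2⟩ := exists_scale t ht.1 ht.2
    refine ⟨n, ?_⟩
    have hle : ∫⁻ φ, ENNReal.ofReal (KKj d c₂ E F α β t θ φ * f φ) ∂(etaM d α β) ≤
        ENNReal.ofReal K * ∫⁻ y, (∏ i, kG c₂ (p i) (p' i) (A i) (B i)
        (Set.Ioo 0 Real.pi ×ˢ Set.Ioo 0 Real.pi) n (θ i) (y i)) * ENNReal.ofReal (g y) ∂(etaM d α β) := by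
      rw [← lintegral_const_mul' _ _ ENNReal.ofReal_ne_top]
      refine lintegral_mono_ae ?_
      filter_upwards [hcube, hfg] with φ hφ hfgφ
      have e1 : KKj d c₂ E F α β t θ φ = ∏ i, kk c₂ (p i) (p' i) (A i) (B i) t (θ i) (φ i) := rfl
      have e2 : ∏ i, kG c₂ (p i) (p' i) (A i) (B i) (Set.Ioo 0 Real.pi ×ˢ Set.Ioo 0 Real.pi) n (θ i) (φ i) =
          ENNReal.ofReal (∏ i, kk c₂ (p i) (p' i) (A i) (B i) ((1 / 4) ^ n) (θ i) (φ i)) := by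
        rw [ENNReal.ofReal_prod_of_nonneg fun i _ => kk_nonneg _ _ _ _ _ _ _ _ (by positivity) (hθ i) (hφ i)]
        refine Finset.prod_congr rfl fun i _ => ?_
        have : (θ i, φ i) ∈ Set.Ioo 0 Real.pi ×ˢ Set.Ioo 0 Real.pi := ⟨hθ i, hφ i⟩
        unfold kG
        rw [if_pos this]
      have hn0 : 0 ≤ ∏ i, kk c₂ (p i) (p' i) (A i) (B i) ((1 / 4) ^ n) (θ i) (φ i) :=
        Finset.prod_nonneg fun i _ => kk_nonneg _ _ _ _ _ _ _ _ (by positivity) (hθ i) (hφ i)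
      rw [e2, ← ENNReal.ofReal_mul hn0, ← ENNReal.ofReal_mul hK0.le, ← hfgφ, ← mul_assoc]
      refine ENNReal.ofReal_le_ofReal (mul_le_mul_of_nonneg_right ?_ (hf0 φ))
      rw [e1, hK, ← Finset.prod_mul_distrib]
      refine Finset.prod_le_prod (fun i _ => kk_nonneg _ _ _ _ _ _ _ _ ht.1 (hθ i) (hφ i)) fun i _ => ?_
      exact hdisc i t _ _ _ ht.1 hn1 hn2 (hθ i) (hφ i)
    rw [ENNReal.ofReal_div_of_pos hK0]
    exact ENNReal.div_lt_of_lt_mul' (hlt.trans_le hle)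
  refine hmono.trans ?_
  have hl : 0 < lam / K := by positivity
  have h1 := (ENNReal.le_div_iff_mul_le (Or.inl (by simpa using hl)) (Or.inl ENNReal.ofReal_ne_top)).2
    ((mul_comm _ _).trans_le hw)
  refine h1.trans ?_
  rw [← ENNReal.ofReal_toReal hC, ← ENNReal.ofReal_mul ENNReal.toReal_nonneg, ← ENNReal.ofReal_div_of_pos hl,
    ENNReal.toReal_ofReal ENNReal.toReal_nonneg]
  refine ENNReal.ofReal_le_ofReal ?_
  have e : C.toReal * (∫ θ, f θ ∂(etaM d α β)) / (lam / K) = K * C.toReal / lam * ∫ θ, f θ ∂(etaM d α β) := by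
    field_simp
  rw [e]
  gcongr
  linarith
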